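/- arXiv:math/9909110 — 4 statements merged into one kernel-verified Lean document; each statement's English description precedes it below -/
import Mathlib

section
/- There is an absolute constant c > 0 and, for every ε ∈ (0,1), a constant C(ε) > 0 depending only on ε, with the following property. Let n, m be positive integers, let (x_j)_{j=1}^m be a decomposition of the identity on the euclidean space ℝⁿ, and let T : ℝⁿ → ℝⁿ be a linear operator with operator norm ‖T‖ = 1. Then there exists a subset σ ⊆ {1,…,m} of cardinality |σ| ≥ (1−ε)‖T‖_HS² such that: (i) the system (T x_j)_{j∈σ} is C(ε)-equivalent to an orthogonal basis in Hilbert space; and (ii) ‖T x_j‖₂ ≥ c √ε (‖T‖_HS/√n) ‖x_j‖₂ for every j ∈ σ. -/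
open scoped RealInnerProductSpace

/-- The square of the Hilbert–Schmidt norm of an operator on `ℝⁿ`,
computed on the canonical orthonormal basis. -/
noncomputable def hsNormSq {n : ℕ}
    (T : EuclideanSpace ℝ (Fin n) →L[ℝ] EuclideanSpace ℝ (Fin n)) : ℝ :=
  ∑ i, ‖T (EuclideanSpace.single i 1)‖ ^ 2

/-- `(y j)_{j ∈ σ}` is `K`-equivalent to an orthogonal basis in Hilbert space:
there are nonzero scalars `λ j` and constants `K₁, K₂` with `K₁ K₂ ≤ K` such that
`(λ j • y j)_{j ∈ σ}` is `K₁K₂`-equivalent to the canonical basis of `l₂^σ`. -/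
def IsEquivToOrthogonalBasis {E : Type*} [NormedAddCommGroup E] [NormedSpace ℝ E] {m : ℕ}
    (K : ℝ) (σ : Finset (Fin m)) (y : Fin m → E) : Prop :=
  ∃ (lam : Fin m → ℝ) (K₁ K₂ : ℝ), (∀ j ∈ σ, lam j ≠ 0) ∧ 0 < K₁ ∧ 0 < K₂ ∧ K₁ * K₂ ≤ K ∧
    ∀ a : Fin m → ℝ,
      K₁⁻¹ * Real.sqrt (∑ j ∈ σ, (a j) ^ 2) ≤ ‖∑ j ∈ σ, (a j * lam j) • y j‖ ∧
      ‖∑ j ∈ σ, (a j * lam j) • y j‖ ≤ K₂ * Real.sqrt (∑ j ∈ σ, (a j) ^ 2)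

/-- A positive operator `R` dominating `V (s (Vᵀ V - τ))⁻¹ Vᵀ`, where `V` is the synthesis operator
of `(v j)_{j ∈ σ}`. For `s = 1` this forces `τ` to be a lower bound of the Gram matrix `Vᵀ V`, for
`s = -1` an upper bound. -/
structure IsBarrier {ι E : Type*} [NormedAddCommGroup E] [InnerProductSpace ℝ E]
    (s τ : ℝ) (σ : Finset ι) (v : ι → E) (R : E →ₗ[ℝ] E) : Prop where
  symm : R.IsSymmetric
  form : ∀ (a : ι → ℝ) (z : E), 0 ≤ s * (‖∑ j ∈ σ, a j • v j‖ ^ 2 - τ * ∑ j ∈ σ, a j ^ 2)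
    + 2 * ⟪∑ j ∈ σ, a j • v j, z⟫ + ⟪R z, z⟫
  resolvent : ∃ B : E →ₗ[ℝ] E, B.IsSymmetric ∧ (∀ z, 0 ≤ ⟪B z, z⟫) ∧
    ∀ z, B (s • R z - z) = (s * τ) • R z

namespace IsBarrier

variable {ι E : Type*} [NormedAddCommGroup E] [InnerProductSpace ℝ E]
  {s τ : ℝ} {σ : Finset ι} {v : ι → E} {R : E →ₗ[ℝ] E}

lemma nonneg (h : IsBarrier s τ σ v R) (z : E) : 0 ≤ ⟪R z, z⟫ := by
  simpa using h.form 0 z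

lemma empty (s τ : ℝ) (v : ι → E) : IsBarrier s τ ∅ v (0 : E →ₗ[ℝ] E) where
  symm := fun x y => by simp
  form := fun a z => by simp
  resolvent := ⟨0, fun x y => by simp, fun z => by simp, fun z => by simp⟩

lemma inner_le_norm_sq (h : IsBarrier s τ σ v R) (hs : s ^ 2 = 1) (hτ : 0 < τ) (z : E) :
    0 ≤ ‖R z‖ ^ 2 - s * ⟪R z, z⟫ := by
  obtain ⟨B, -, hB0, hB⟩ := h.resolvent
  have h1 := hB0 (s • R z - z)
  rw [hB, inner_sub_right, inner_smul_left, inner_smul_left, inner_smul_right,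
    real_inner_self_eq_norm_sq] at h1
  simp only [conj_trivial] at h1
  have h2 : 0 ≤ τ * (‖R z‖ ^ 2 - s * ⟪R z, z⟫) := by
    have : s * τ * (s * ‖R z‖ ^ 2) - s * τ * ⟪R z, z⟫
        = s ^ 2 * τ * ‖R z‖ ^ 2 - s * τ * ⟪R z, z⟫ := by ring
    rw [this, hs] at h1
    linarith
  exact nonneg_of_mul_nonneg_right h2 hτ

/-- Moving the barrier from `τ` to `r τ` gains a quadratic term. -/
lemma exists_shift [FiniteDimensional ℝ E] (h : IsBarrier s τ σ v R) (hs : s ^ 2 = 1)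
    {r ρ : ℝ} (hr : 0 < r) (hρ : ρ = s * (1 - r)) (hρ0 : 0 ≤ ρ) :
    ∃ R' : E →ₗ[ℝ] E, IsBarrier s (r * τ) σ v R' ∧
      ∀ z, ⟪R' z, z⟫ + ρ / r * (‖R' z‖ ^ 2 - s * ⟪R' z, z⟫) ≤ ⟪R z, z⟫ := by
  have hsρ : s * ρ = 1 - r := by rw [hρ, ← mul_assoc, ← sq, hs, one_mul]
  set M : E →ₗ[ℝ] E := r • LinearMap.id + ρ • R with hM
  have hMa : ∀ z, M z = r • z + ρ • R z := fun z => by simp [hM]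
  have hinj : Function.Injective M := by
    rw [injective_iff_map_eq_zero]
    intro q hq
    have h1 : ⟪M q, q⟫ = 0 := by rw [hq, inner_zero_left]
    rw [hMa, inner_add_left, inner_smul_left, inner_smul_left, real_inner_self_eq_norm_sq] at h1
    simp only [conj_trivial] at h1
    have h2 := mul_nonneg hρ0 (h.nonneg q)
    have h3 : r * ‖q‖ ^ 2 ≤ 0 := by linarith
    have h4 : ‖q‖ ^ 2 ≤ 0 := nonpos_of_mul_nonpos_right h3 hr
    have h5 : ‖q‖ = 0 := by nlinarith [norm_nonneg q]
    exact norm_eq_zero.1 h5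
  let e := LinearEquiv.ofInjectiveEndo M hinj
  have hq : ∀ z, z = r • e.symm z + ρ • R (e.symm z) := fun z => by
    rw [← hMa]; exact (e.apply_symm_apply z).symm
  have hR : ∀ x y, ⟪R x, y⟫ = ⟪x, R y⟫ := h.symm
  refine ⟨R ∘ₗ (e.symm : E →ₗ[ℝ] E), ⟨?_, ?_, ?_⟩, ?_⟩
  · intro x y
    simp only [LinearMap.comp_apply, LinearEquiv.coe_coe]
    have hx := hq x
    have hy := hq y
    set p := e.symm x
    set q := e.symm y
    rw [hx, hy]
    simp only [map_add, map_smul, inner_add_left, inner_add_right, inner_smul_left,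
      inner_smul_right, conj_trivial, hR]
  · intro a z
    simp only [LinearMap.comp_apply, LinearEquiv.coe_coe]
    have hz := hq z
    set q := e.symm z
    have h1 := h.form a q
    set y := ∑ j ∈ σ, a j • v j
    have h2 : 0 ≤ ‖y + R q‖ ^ 2 := sq_nonneg _
    rw [norm_add_sq_real] at h2
    rw [hz]
    simp only [inner_add_right, inner_smul_right, real_inner_self_eq_norm_sq]
    have h3 := mul_nonneg hr.le h1
    have h4 := mul_nonneg hρ0 h2
    have h5 : s * (‖y‖ ^ 2 - r * τ * ∑ j ∈ σ, a j ^ 2)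
        = r * (s * (‖y‖ ^ 2 - τ * ∑ j ∈ σ, a j ^ 2)) + ρ * ‖y‖ ^ 2 := by
      rw [hρ]; ring
    rw [h5]
    linarith
  · obtain ⟨B, hB1, hB2, hB⟩ := h.resolvent
    refine ⟨B, hB1, hB2, fun z => ?_⟩
    simp only [LinearMap.comp_apply, LinearEquiv.coe_coe]
    have hz := hq z
    set q := e.symm z
    have h1 : s • R q - z = r • (s • R q - q) := by
      have h2 : s • R q - r • q - ρ • R q = (s - ρ) • R q - r • q := by module
      have h3 : s - ρ = r * s := by rw [hρ]; ring
      rw [hz, ← sub_sub, h2, h3]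
      module
    rw [h1, map_smul, hB, smul_smul]
    congr 1
    ring
  · intro z
    simp only [LinearMap.comp_apply, LinearEquiv.coe_coe]
    have hz := hq z
    set q := e.symm z
    have h1 := h.nonneg (R q - s • q)
    have hRz : R z = r • R q + ρ • R (R q) := by rw [hz]; simp
    have hb : ⟪R (R q), q⟫ = ‖R q‖ ^ 2 := by rw [hR, real_inner_self_eq_norm_sq]
    simp only [map_sub, map_smul, inner_sub_left, inner_sub_right, inner_smul_left,
      inner_smul_right, conj_trivial, real_inner_self_eq_norm_sq, hb] at h1
    have hA : ⟪R q, z⟫ = r * ⟪R q, q⟫ + ρ * ‖R q‖ ^ 2 := by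
      conv_lhs => rw [hz]
      simp only [inner_add_right, inner_smul_right, real_inner_self_eq_norm_sq]
    have hC : ⟪R z, z⟫ = r ^ 2 * ⟪R q, q⟫ + 2 * r * ρ * ‖R q‖ ^ 2
        + ρ ^ 2 * ⟪R (R q), R q⟫ := by
      rw [hRz]
      conv_lhs => rw [hz]
      simp only [inner_add_left, inner_add_right, inner_smul_left, inner_smul_right, conj_trivial,
        real_inner_self_eq_norm_sq, hb]
      ring
    have hD : ρ / r * (‖R q‖ ^ 2 - s * ⟪R q, z⟫) = ρ * (‖R q‖ ^ 2 - s * ⟪R q, q⟫) := by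
      have : ‖R q‖ ^ 2 - s * ⟪R q, z⟫ = r * (‖R q‖ ^ 2 - s * ⟪R q, q⟫) := by
        rw [hA]
        linear_combination -‖R q‖ ^ 2 * hsρ
      rw [this]
      field_simp
    rw [hD, hA, hC]
    have h2 := mul_nonneg (sq_nonneg ρ) h1
    have hr' : r = 1 - s * ρ := by linarith
    have h3 : s ^ 2 * ρ ^ 2 = ρ ^ 2 := by rw [hs, one_mul]
    rw [hr']
    have h4 : s ^ 2 * ρ ^ 2 * ⟪R q, q⟫ = ρ ^ 2 * ⟪R q, q⟫ := by rw [h3]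
    linarith

lemma notMem_of_pos (h : IsBarrier 1 τ σ v R) (hτ : 0 < τ) {i : ι} (hv : ‖v i‖ = 1)
    (hδ : 0 < 1 * (1 - τ) - ⟪R (v i), v i⟫) : i ∉ σ := by
  classical
  intro hi
  have h1 := h.form (fun j => if j = i then -1 else 0) (v i)
  simp [hi, hv, inner_neg_left, Finset.sum_ite_eq', ite_smul] at h1
  linarith

/-- Adding a unit vector on the right side of the barrier is a rank-one update. -/
lemma insert [DecidableEq ι] (h : IsBarrier s τ σ v R) (hs : s ^ 2 = 1) {i : ι} (hi : i ∉ σ)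
    (hv : ‖v i‖ = 1) {δ : ℝ} (hδ : δ = s * (1 - τ) - ⟪R (v i), v i⟫) (hδ0 : 0 < δ) {w : E}
    (hw : w = v i - s • R (v i)) :
    IsBarrier s τ (insert i σ) v (R + δ⁻¹ • (innerₛₗ ℝ w).smulRight w) := by
  have hR : ∀ x y, ⟪R x, y⟫ = ⟪x, R y⟫ := h.symm
  refine ⟨?_, ?_, ?_⟩
  · intro x y
    simp [inner_add_left, inner_add_right, inner_smul_left, inner_smul_right, hR]
    rw [real_inner_comm w x]
    ring_nf
    simp
  · intro a z
    rw [Finset.sum_insert hi, Finset.sum_insert hi]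
    have h1 := h.form a (z + (s * a i) • v i)
    set y := ∑ j ∈ σ, a j • v j
    set t := a i
    have hvw : ⟪w, z⟫ = ⟪v i, z⟫ - s * ⟪R (v i), z⟫ := by
      rw [hw, inner_sub_left, inner_smul_left]; simp
    have hc : ⟪R z, v i⟫ = ⟪R (v i), z⟫ := by rw [hR, real_inner_comm]
    simp only [map_add, map_smul, inner_add_left, inner_add_right, inner_smul_left,
      inner_smul_right, conj_trivial, hc] at h1
    simp only [LinearMap.add_apply, LinearMap.smul_apply, LinearMap.smulRight_apply,
      innerₛₗ_apply_apply, inner_add_left, inner_smul_left, conj_trivial]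
    have hn : ‖t • v i + y‖ ^ 2 = t ^ 2 + 2 * (t * ⟪y, v i⟫) + ‖y‖ ^ 2 := by
      rw [norm_add_sq_real, norm_smul, hv, inner_smul_left, real_inner_comm]
      simp
    have hsq : 0 ≤ δ⁻¹ * (t * δ + ⟪w, z⟫) ^ 2 := by positivity
    have hexp : δ⁻¹ * (t * δ + ⟪w, z⟫) ^ 2
        = t ^ 2 * δ + 2 * t * ⟪w, z⟫ + δ⁻¹ * (⟪w, z⟫ * ⟪w, z⟫) := by
      field_simp
      ring
    rw [hexp] at hsq
    have hq : ⟪R (v i), v i⟫ = s * (1 - τ) - δ := by linarith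
    rw [hn]
    rw [hq] at h1
    rw [hvw] at hsq ⊢
    have e1 : s * t * (⟪R (v i), z⟫ + s * t * (s * (1 - τ) - δ))
        = s * t * ⟪R (v i), z⟫ + t ^ 2 * (s * (1 - τ) - δ) := by
      linear_combination t ^ 2 * (s * (1 - τ) - δ) * hs
    rw [e1] at h1
    linarith
  · obtain ⟨B, hB1, hB2, hB⟩ := h.resolvent
    refine ⟨B + (innerₛₗ ℝ (v i)).smulRight (v i), ?_, ?_, ?_⟩
    · intro x y
      have := hB1 x y
      simp [inner_add_left, inner_add_right, inner_smul_left, inner_smul_right, this]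
      rw [real_inner_comm (v i) x]
      ring
    · intro z
      have := hB2 z
      simp only [LinearMap.add_apply, LinearMap.smulRight_apply, innerₛₗ_apply_apply,
        inner_add_left, inner_smul_left, conj_trivial]
      nlinarith [mul_self_nonneg ⟪v i, z⟫]
    · intro z
      have hBw : B w = τ • (w - v i) := by
        have h1 : w = -(s • R (v i) - v i) := by rw [hw]; abel
        conv_lhs => rw [h1]
        rw [map_neg, hB, hw]
        module
      have hvw : ⟪v i, w⟫ = τ + s * δ := by
        rw [hw, inner_sub_right, inner_smul_right, real_inner_self_eq_norm_sq, hv,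
          real_inner_comm, hδ]
        linear_combination -(1 - τ) * hs
      have hvz : ⟪v i, s • R z - z⟫ = -⟪w, z⟫ := by
        rw [hw, inner_sub_right, inner_sub_left, inner_smul_right, inner_smul_left, hR]
        simp
      have hsplit : s • (R + δ⁻¹ • (innerₛₗ ℝ w).smulRight w) z - z
          = (s • R z - z) + (s * δ⁻¹ * ⟪w, z⟫) • w := by
        simp only [LinearMap.add_apply, LinearMap.smul_apply, LinearMap.smulRight_apply,
          innerₛₗ_apply_apply]
        module
      rw [hsplit]
      simp only [LinearMap.add_apply, LinearMap.smul_apply, LinearMap.smulRight_apply,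
        innerₛₗ_apply_apply, map_add, map_smul, hB, hBw, hvw, hvz]
      have hcoef : s * δ⁻¹ * ⟪w, z⟫ * (-τ) + (-⟪w, z⟫ + s * δ⁻¹ * ⟪w, z⟫ * (τ + s * δ)) = 0 := by
        have : δ⁻¹ * δ = 1 := inv_mul_cancel₀ hδ0.ne'
        linear_combination ⟪w, z⟫ * s ^ 2 * this + ⟪w, z⟫ * hs
      have : (s * τ) • R z + (s * δ⁻¹ * ⟪w, z⟫) • τ • (w - v i)
          + (-⟪w, z⟫ + s * δ⁻¹ * ⟪w, z⟫ * (τ + s * δ)) • v i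
          = (s * τ) • (R z + δ⁻¹ • ⟪w, z⟫ • w)
            + (s * δ⁻¹ * ⟪w, z⟫ * (-τ) + (-⟪w, z⟫ + s * δ⁻¹ * ⟪w, z⟫ * (τ + s * δ))) • v i := by
        module
      rw [hcoef, zero_smul, add_zero] at this
      rw [← this]
      module

/-- The rank-one update, with control of the potential weighted by a Bessel sequence. -/
lemma exists_insert [DecidableEq ι] (h : IsBarrier s τ σ v R) (hs : s ^ 2 = 1) {J : Finset ι}
    {p : ι → ℝ} (hp : ∀ z, ∑ j ∈ J, p j * ⟪v j, z⟫ ^ 2 ≤ ‖z‖ ^ 2) {i : ι} (hi : i ∉ σ)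
    (hv : ‖v i‖ = 1) (hδ : 0 < s * (1 - τ) - ⟪R (v i), v i⟫) {g : ℝ}
    (hg : ‖R (v i)‖ ^ 2 - s * ⟪R (v i), v i⟫ + τ ≤ (s * (1 - τ) - ⟪R (v i), v i⟫) * g) :
    ∃ R' : E →ₗ[ℝ] E, IsBarrier s τ (Insert.insert i σ) v R' ∧
      ∑ j ∈ J, p j * ⟪R' (v j), v j⟫ ≤ ∑ j ∈ J, p j * ⟪R (v j), v j⟫ + (s + g) := by
  refine ⟨_, h.insert hs hi hv rfl hδ rfl, ?_⟩
  set δ := s * (1 - τ) - ⟪R (v i), v i⟫ with hδ'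
  set w := v i - s • R (v i) with hw
  have h1 : ∀ j, p j * ⟪(R + δ⁻¹ • (innerₛₗ ℝ w).smulRight w) (v j), v j⟫
      = p j * ⟪R (v j), v j⟫ + δ⁻¹ * (p j * ⟪v j, w⟫ ^ 2) := fun j => by
    simp only [LinearMap.add_apply, LinearMap.smul_apply, LinearMap.smulRight_apply,
      innerₛₗ_apply_apply, inner_add_left, inner_smul_left, conj_trivial]
    rw [real_inner_comm (v j) w]
    ring
  simp only [h1, Finset.sum_add_distrib, ← Finset.mul_sum]
  have hn : ‖w‖ ^ 2 = ‖R (v i)‖ ^ 2 - s * ⟪R (v i), v i⟫ + τ + s * δ := by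
    rw [hw, norm_sub_sq_real, norm_smul, mul_pow, Real.norm_eq_abs, sq_abs, hs, hv,
      inner_smul_right, real_inner_comm, hδ']
    linear_combination -(1 - τ) * hs
  have h2 : δ⁻¹ * ∑ j ∈ J, p j * ⟪v j, w⟫ ^ 2 ≤ δ⁻¹ * (δ * (s + g)) := by
    apply mul_le_mul_of_nonneg_left _ (inv_nonneg.2 hδ.le)
    have := hp w
    linarith
  rw [inv_mul_cancel_left₀ hδ.ne'] at h2
  linarith

end IsBarrier

/-- The averaging argument choosing a vector that passes both barriers. -/
lemma exists_le_of_averages {ι : Type*} {J : Finset ι} {p α d β f : ι → ℝ} {e b u h : ℝ}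
    (he0 : 0 < e) (he1 : e < 1) (hp : ∀ j ∈ J, 0 ≤ p j) (hh : ∑ j ∈ J, p j = h) (hh2 : 1 / 2 ≤ h)
    (hα : ∀ j, 0 ≤ α j) (hd : ∀ j, 0 ≤ d j) (hβ : ∀ j, 0 ≤ β j) (hf : ∀ j, 0 ≤ f j)
    (hb : 0 < b) (hb1 : b ≤ e ^ 2 / 16) (hu : 400 / e ^ 2 ≤ u)
    (hαs : ∑ j ∈ J, p j * α j ≤ (1 - e / 2) * h) (hβs : ∑ j ∈ J, p j * β j ≤ 16 / e * h) :
    ∃ j ∈ J,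
      d j + b ≤ (1 - b - α j) * (e / 2 + 8 / (e * h) * ∑ j ∈ J, p j * d j) ∧
      f j + u ≤ (u - 1 - β j) * (16 / e + 1 / (h + 1) * ∑ j ∈ J, p j * f j) := by
  have hh0 : 0 < h := by linarith
  set D := ∑ j ∈ J, p j * d j
  set F := ∑ j ∈ J, p j * f j
  have hD : 0 ≤ D := Finset.sum_nonneg fun j hj => mul_nonneg (hp j hj) (hd j)
  have hF : 0 ≤ F := Finset.sum_nonneg fun j hj => mul_nonneg (hp j hj) (hf j)
  set G := e / 2 + 8 / (e * h) * D with hG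
  set G' := 16 / e + 1 / (h + 1) * F with hG'
  have hG0 : 0 < G := by positivity
  have hG'0 : 0 < G' := by positivity
  have heu : 400 ≤ e ^ 2 * u := by rwa [div_le_iff₀' (by positivity)] at hu
  have hu1 : 1 < u := by nlinarith
  by_contra! hcon
  have key : ∀ j ∈ J, p j * (1 - b - α j - (d j + b) / G)
      ≤ p j * ((β j + (f j + u) / G') / (u - 1)) := by
    intro j hj
    apply mul_le_mul_of_nonneg_left _ (hp j hj)
    have hX : 0 ≤ β j + (f j + u) / G' := by
      have := hβ j
      have := hf j
      positivity
    rcases lt_or_ge ((1 - b - α j) * G) (d j + b) with h1 | h1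
    · rw [← lt_div_iff₀ hG0] at h1
      have : 0 ≤ (β j + (f j + u) / G') / (u - 1) := div_nonneg hX (by linarith)
      linarith
    · have h2 := hcon j hj h1
      rw [← lt_div_iff₀ hG'0] at h2
      have h3 : 1 ≤ (β j + (f j + u) / G') / (u - 1) := by
        rw [le_div_iff₀ (by linarith)]
        linarith
      have h4 : 0 ≤ (d j + b) / G := div_nonneg (by linarith [hd j]) hG0.le
      linarith [hα j]
  have hsum := Finset.sum_le_sum key
  have hl : ∑ j ∈ J, p j * (1 - b - α j - (d j + b) / G)
      = (1 - b) * h - ∑ j ∈ J, p j * α j - (D + b * h) / G := by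
    rw [← hh, Finset.mul_sum, Finset.mul_sum, ← Finset.sum_add_distrib, Finset.sum_div,
      ← Finset.sum_sub_distrib, ← Finset.sum_sub_distrib]
    exact Finset.sum_congr rfl fun j _ => by ring
  have hr : ∑ j ∈ J, p j * ((β j + (f j + u) / G') / (u - 1))
      = (∑ j ∈ J, p j * β j + (F + u * h) / G') / (u - 1) := by
    rw [← hh, Finset.mul_sum, ← Finset.sum_add_distrib, Finset.sum_div,
      ← Finset.sum_add_distrib, Finset.sum_div]
    exact Finset.sum_congr rfl fun j _ => by ring
  rw [hl, hr] at hsum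
  have h1 : (D + b * h) / G ≤ e * h / 4 := by
    rw [div_le_iff₀ hG0]
    have : e * h / 4 * G = e ^ 2 / 8 * h + 2 * D := by
      rw [hG]; field_simp; ring
    rw [this]
    nlinarith
  have h2 : (F + u * h) / G' ≤ (h + 1) + e * u * h / 16 := by
    rw [div_le_iff₀ hG'0]
    have h3 : (h + 1) * (1 / (h + 1) * F) = F := by field_simp
    have h4 : e * u * h / 16 * (16 / e) = u * h := by field_simp
    have h5 : 0 ≤ (h + 1) * (16 / e) := by positivity
    have h6 : 0 ≤ e * u * h / 16 * (1 / (h + 1) * F) := by positivity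
    rw [hG']
    linarith
  have h3 : (∑ j ∈ J, p j * β j + (F + u * h) / G') / (u - 1) ≤ e * h / 8 := by
    rw [div_le_iff₀ (by linarith)]
    have h4 : 25 / e ≤ e * u / 16 := by
      rw [div_le_iff₀ he0]; nlinarith
    have h5 : 9 ≤ 9 / e := by rw [le_div_iff₀ he0]; linarith
    have h6 : 25 / e = 16 / e + 9 / e := by ring
    have h7 : 16 / e + 9 ≤ e * u / 16 := by linarith
    have h8 := mul_le_mul_of_nonneg_right h7 hh0.le
    nlinarith
  have h4 : e ^ 2 < e := by nlinarith
  nlinarith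

section Selection

variable {ι E : Type*} [NormedAddCommGroup E] [InnerProductSpace ℝ E] [FiniteDimensional ℝ E]
  [DecidableEq ι] {J : Finset ι} {v : ι → E} {p : ι → ℝ} {e h : ℝ}

lemma exists_barrier_step (he0 : 0 < e) (he1 : e < 1) (hv : ∀ j ∈ J, ‖v j‖ = 1)
    (hp0 : ∀ j ∈ J, 0 ≤ p j) (hp : ∀ z, ∑ j ∈ J, p j * ⟪v j, z⟫ ^ 2 ≤ ‖z‖ ^ 2)
    (hh : ∑ j ∈ J, p j = h) (hh2 : 1 / 2 ≤ h) {σ : Finset ι} {b u t : ℝ} {R S : E →ₗ[ℝ] E}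
    (hb : 0 < b) (hb1 : b ≤ e ^ 2 / 16) (hu : 400 / e ^ 2 ≤ u) (ht : t ≤ (1 - e) * h)
    (hR : IsBarrier 1 b σ v R) (hS : IsBarrier (-1) u σ v S)
    (hRt : ∑ j ∈ J, p j * ⟪R (v j), v j⟫ ≤ (1 + e / 2) * t)
    (hSt : ∑ j ∈ J, p j * ⟪S (v j), v j⟫ ≤ 16 / e * t) :
    ∃ i ∈ J, i ∉ σ ∧ ∃ R' S' : E →ₗ[ℝ] E,
      IsBarrier 1 ((1 + 8 / (e * h))⁻¹ * b) (insert i σ) v R' ∧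
      IsBarrier (-1) ((1 + 1 / h) * u) (insert i σ) v S' ∧
      ∑ j ∈ J, p j * ⟪R' (v j), v j⟫ ≤ (1 + e / 2) * (t + 1) ∧
      ∑ j ∈ J, p j * ⟪S' (v j), v j⟫ ≤ 16 / e * (t + 1) := by
  have hh0 : 0 < h := by linarith
  have hu0 : 0 < u := lt_of_lt_of_le (by positivity) hu
  set k := 8 / (e * h) with hk
  have hk0 : 0 < k := by positivity
  have hr1 : (1 + k)⁻¹ ≤ 1 := inv_le_one_of_one_le₀ (by linarith)
  obtain ⟨R₁, hR₁, hRR⟩ := hR.exists_shift (by norm_num) (r := (1 + k)⁻¹) (by positivity) rfl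
    (by linarith)
  obtain ⟨S₁, hS₁, hSS⟩ := hS.exists_shift (by norm_num) (r := 1 + 1 / h) (by positivity) rfl
    (by have : 0 ≤ 1 / h := by positivity
        linarith)
  have hc1 : 1 * (1 - (1 + k)⁻¹) / (1 + k)⁻¹ = k := by field_simp; ring
  have hc2 : -1 * (1 - (1 + 1 / h)) / (1 + 1 / h) = 1 / (h + 1) := by field_simp; ring
  rw [hc1] at hRR
  rw [hc2] at hSS
  set b' := (1 + k)⁻¹ * b
  set u' := (1 + 1 / h) * u
  have hb'0 : 0 < b' := by positivity
  have hb'1 : b' ≤ e ^ 2 / 16 := by nlinarith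
  have hu' : 400 / e ^ 2 ≤ u' := by
    have : 0 ≤ 1 / h * u := by positivity
    linarith [show u' = u + 1 / h * u by ring]
  have hu'0 : 0 < u' := by positivity
  have hdR : ∀ z, 0 ≤ ‖R₁ z‖ ^ 2 - 1 * ⟪R₁ z, z⟫ := hR₁.inner_le_norm_sq (by norm_num) hb'0
  have hdS : ∀ z, 0 ≤ ‖S₁ z‖ ^ 2 - -1 * ⟪S₁ z, z⟫ := hS₁.inner_le_norm_sq (by norm_num) hu'0
  have hsumR : ∑ j ∈ J, p j * ⟪R₁ (v j), v j⟫
      + k * ∑ j ∈ J, p j * (‖R₁ (v j)‖ ^ 2 - 1 * ⟪R₁ (v j), v j⟫) ≤ (1 + e / 2) * t := by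
    refine le_trans ?_ hRt
    rw [Finset.mul_sum, ← Finset.sum_add_distrib]
    refine Finset.sum_le_sum fun j hj => ?_
    linarith [mul_le_mul_of_nonneg_left (hRR (v j)) (hp0 j hj)]
  have hsumS : ∑ j ∈ J, p j * ⟪S₁ (v j), v j⟫
      + 1 / (h + 1) * ∑ j ∈ J, p j * (‖S₁ (v j)‖ ^ 2 - -1 * ⟪S₁ (v j), v j⟫) ≤ 16 / e * t := by
    refine le_trans ?_ hSt
    rw [Finset.mul_sum, ← Finset.sum_add_distrib]
    refine Finset.sum_le_sum fun j hj => ?_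
    linarith [mul_le_mul_of_nonneg_left (hSS (v j)) (hp0 j hj)]
  have hD : 0 ≤ ∑ j ∈ J, p j * (‖R₁ (v j)‖ ^ 2 - 1 * ⟪R₁ (v j), v j⟫) :=
    Finset.sum_nonneg fun j hj => mul_nonneg (hp0 j hj) (hdR _)
  have hF : 0 ≤ ∑ j ∈ J, p j * (‖S₁ (v j)‖ ^ 2 - -1 * ⟪S₁ (v j), v j⟫) :=
    Finset.sum_nonneg fun j hj => mul_nonneg (hp0 j hj) (hdS _)
  have hαs : ∑ j ∈ J, p j * ⟪R₁ (v j), v j⟫ ≤ (1 - e / 2) * h := by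
    have h1 := mul_nonneg hk0.le hD
    have h2 : (1 + e / 2) * t ≤ (1 + e / 2) * ((1 - e) * h) :=
      mul_le_mul_of_nonneg_left ht (by linarith)
    have h3 : 0 ≤ e ^ 2 / 2 * h := by positivity
    linarith
  have hβs : ∑ j ∈ J, p j * ⟪S₁ (v j), v j⟫ ≤ 16 / e * h := by
    have h1 : 0 ≤ 1 / (h + 1) * ∑ j ∈ J, p j * (‖S₁ (v j)‖ ^ 2 - -1 * ⟪S₁ (v j), v j⟫) :=
      mul_nonneg (by positivity) hF
    have h2 : 16 / e * t ≤ 16 / e * h := mul_le_mul_of_nonneg_left (by nlinarith) (by positivity)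
    linarith
  obtain ⟨i, hiJ, hi1, hi2⟩ := exists_le_of_averages he0 he1 hp0 hh hh2
    (fun j => hR₁.nonneg (v j)) (fun j => hdR (v j)) (fun j => hS₁.nonneg (v j))
    (fun j => hdS (v j)) hb'0 hb'1 hu' hαs hβs
  set D := ∑ j ∈ J, p j * (‖R₁ (v j)‖ ^ 2 - 1 * ⟪R₁ (v j), v j⟫)
  set F := ∑ j ∈ J, p j * (‖S₁ (v j)‖ ^ 2 - -1 * ⟪S₁ (v j), v j⟫)
  have hδR : 0 < 1 * (1 - b') - ⟪R₁ (v i), v i⟫ := by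
    have h1 : 0 < (1 - b' - ⟪R₁ (v i), v i⟫) * (e / 2 + k * D) := by linarith [hdR (v i)]
    have := pos_of_mul_pos_left h1 (by positivity)
    linarith
  have hδS : 0 < -1 * (1 - u') - ⟪S₁ (v i), v i⟫ := by
    have h1 : 0 < (u' - 1 - ⟪S₁ (v i), v i⟫) * (16 / e + 1 / (h + 1) * F) := by
      linarith [hdS (v i)]
    have := pos_of_mul_pos_left h1 (by positivity)
    linarith
  have hiσ := hR₁.notMem_of_pos hb'0 (hv i hiJ) hδR
  obtain ⟨R', hR', hR't⟩ := hR₁.exists_insert (by norm_num) hp hiσ (hv i hiJ) hδR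
    (g := e / 2 + k * D) (by linarith)
  obtain ⟨S', hS', hS't⟩ := hS₁.exists_insert (by norm_num) hp hiσ (hv i hiJ) hδS
    (g := 16 / e + 1 / (h + 1) * F) (by linarith)
  exact ⟨i, hiJ, hiσ, R', S', hR', hS', by linarith, by linarith⟩

lemma exists_barriers (he0 : 0 < e) (he1 : e < 1) (hv : ∀ j ∈ J, ‖v j‖ = 1)
    (hp0 : ∀ j ∈ J, 0 ≤ p j) (hp : ∀ z, ∑ j ∈ J, p j * ⟪v j, z⟫ ^ 2 ≤ ‖z‖ ^ 2)
    (hh : ∑ j ∈ J, p j = h) (hh2 : 1 / 2 ≤ h) (k : ℕ)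
    (hk : ∀ t : ℕ, t < k → (t : ℝ) ≤ (1 - e) * h) :
    ∃ σ ⊆ J, σ.card = k ∧ ∃ R S : E →ₗ[ℝ] E,
      IsBarrier 1 ((1 + 8 / (e * h))⁻¹ ^ k * (e ^ 2 / 16)) σ v R ∧
      IsBarrier (-1) ((1 + 1 / h) ^ k * (400 / e ^ 2)) σ v S ∧
      ∑ j ∈ J, p j * ⟪R (v j), v j⟫ ≤ (1 + e / 2) * k ∧
      ∑ j ∈ J, p j * ⟪S (v j), v j⟫ ≤ 16 / e * k := by
  have hh0 : 0 < h := by linarith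
  induction k with
  | zero => exact ⟨∅, by simp, by simp, 0, 0, .empty _ _ _, .empty _ _ _, by simp, by simp⟩
  | succ k ih =>
    obtain ⟨σ, hσ, hc, R, S, hR, hS, hRt, hSt⟩ := ih fun t ht => hk t (by omega)
    have h1 : (1 + 8 / (e * h))⁻¹ ^ k ≤ 1 := by
      have : 0 ≤ 8 / (e * h) := by positivity
      exact pow_le_one₀ (by positivity) (inv_le_one_of_one_le₀ (by linarith))
    have h2 : 1 ≤ (1 + 1 / h) ^ k := by
      have : 0 ≤ 1 / h := by positivity
      exact one_le_pow₀ (by linarith)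
    obtain ⟨i, hiJ, hi, R', S', hR', hS', hR't, hS't⟩ := exists_barrier_step
      he0 he1 hv hp0 hp hh hh2
      (by positivity) (mul_le_of_le_one_left (by positivity) h1)
      (le_mul_of_one_le_left (by positivity) h2) (hk k (by omega)) hR hS hRt hSt
    refine ⟨insert i σ, Finset.insert_subset hiJ hσ, by rw [Finset.card_insert_of_notMem hi, hc],
      R', S', ?_, ?_, by exact_mod_cast hR't, by exact_mod_cast hS't⟩
    · rwa [pow_succ', mul_assoc]
    · rwa [pow_succ', mul_assoc]

/-- From a weighted Bessel family of unit vectors of total weight `h` one can extract `(1 - e) h`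
vectors forming a Riesz sequence with constants depending only on `e`. -/
theorem exists_riesz_subset (he0 : 0 < e) (he1 : e < 1) (hv : ∀ j ∈ J, ‖v j‖ = 1)
    (hp0 : ∀ j ∈ J, 0 ≤ p j) (hp : ∀ z, ∑ j ∈ J, p j * ⟪v j, z⟫ ^ 2 ≤ ‖z‖ ^ 2)
    (hh : ∑ j ∈ J, p j = h) (hh2 : 1 / 2 ≤ h) :
    ∃ σ ⊆ J, (1 - e) * h ≤ σ.card ∧ ∀ a : ι → ℝ,
      (Real.exp (24 / e))⁻¹ * (e ^ 2 / 16) * ∑ j ∈ σ, a j ^ 2 ≤ ‖∑ j ∈ σ, a j • v j‖ ^ 2 ∧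
      ‖∑ j ∈ σ, a j • v j‖ ^ 2 ≤ Real.exp 3 * (400 / e ^ 2) * ∑ j ∈ σ, a j ^ 2 := by
  have hh0 : 0 < h := by linarith
  obtain ⟨σ, hσ, hc, R, S, hR, hS, -, -⟩ := exists_barriers he0 he1 hv hp0 hp hh hh2
    ⌈(1 - e) * h⌉₊ fun t ht => (Nat.lt_ceil.1 ht).le
  set k := ⌈(1 - e) * h⌉₊ with hk
  have hk3 : (k : ℝ) ≤ 3 * h := by
    have := Nat.ceil_lt_add_one (a := (1 - e) * h) (mul_nonneg (by linarith) hh0.le)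
    rw [← hk] at this
    nlinarith
  refine ⟨σ, hσ, by rw [hc]; exact Nat.le_ceil _, fun a => ?_⟩
  have hA : 0 ≤ ∑ j ∈ σ, a j ^ 2 := Finset.sum_nonneg fun j _ => sq_nonneg _
  have h1 := hR.form a 0
  have h2 := hS.form a 0
  simp only [inner_zero_right, map_zero] at h1 h2
  have hexp : ∀ c : ℝ, 0 ≤ c → (1 + c / h) ^ k ≤ Real.exp (3 * c) := fun c hc0 => by
    have hc' : 0 ≤ c / h := by positivity
    calc (1 + c / h) ^ k ≤ Real.exp (c / h) ^ k :=
          pow_le_pow_left₀ (by linarith) (by linarith [Real.add_one_le_exp (c / h)]) _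
      _ = Real.exp (k * (c / h)) := (Real.exp_nat_mul _ _).symm
      _ ≤ Real.exp (3 * c) := by
          apply Real.exp_le_exp.2
          calc (k : ℝ) * (c / h) ≤ 3 * h * (c / h) := mul_le_mul_of_nonneg_right hk3 hc'
            _ = 3 * c := by field_simp
  constructor
  · have h3 : (Real.exp (24 / e))⁻¹ ≤ (1 + 8 / (e * h))⁻¹ ^ k := by
      rw [inv_pow]
      apply inv_anti₀ (by positivity)
      have := hexp (8 / e) (by positivity)
      rwa [div_div, show 3 * (8 / e) = 24 / e by ring] at this
    have h4 := mul_le_mul_of_nonneg_right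
      (mul_le_mul_of_nonneg_right h3 (by positivity : (0 : ℝ) ≤ e ^ 2 / 16)) hA
    linarith
  · have h3 := hexp 1 zero_le_one
    rw [mul_one] at h3
    have h4 := mul_le_mul_of_nonneg_right
      (mul_le_mul_of_nonneg_right h3 (by positivity : (0 : ℝ) ≤ 400 / e ^ 2)) hA
    linarith

end Selection

section Decomposition

variable {n m : ℕ} {x : Fin m → EuclideanSpace ℝ (Fin n)}

lemma sum_inner_sq_of_decomposition
    (hx : ∀ v : EuclideanSpace ℝ (Fin n), ∑ j, ⟪x j, v⟫ • x j = v)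
    (z : EuclideanSpace ℝ (Fin n)) : ∑ j, ⟪x j, z⟫ ^ 2 = ‖z‖ ^ 2 := by
  have h := congrArg (fun y => ⟪y, z⟫) (hx z)
  simp only [sum_inner, inner_smul_left, conj_trivial, real_inner_self_eq_norm_sq] at h
  rw [← h]
  refine Finset.sum_congr rfl fun j _ => sq _

lemma hsNormSq_adjoint (T : EuclideanSpace ℝ (Fin n) →L[ℝ] EuclideanSpace ℝ (Fin n)) :
    hsNormSq T.adjoint = hsNormSq T := by
  have h : ∀ S : EuclideanSpace ℝ (Fin n) →L[ℝ] EuclideanSpace ℝ (Fin n), hsNormSq S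
      = ∑ i, ∑ k, ⟪S (EuclideanSpace.single i 1), EuclideanSpace.single k 1⟫ ^ 2 := by
    intro S
    refine Finset.sum_congr rfl fun i _ => ?_
    rw [EuclideanSpace.norm_sq_eq]
    simp [EuclideanSpace.inner_single_right]
  rw [h, h, Finset.sum_comm]
  refine Finset.sum_congr rfl fun i _ => Finset.sum_congr rfl fun k _ => ?_
  rw [ContinuousLinearMap.adjoint_inner_left, real_inner_comm]

lemma norm_sq_eq_sum_inner_adjoint (T : EuclideanSpace ℝ (Fin n) →L[ℝ] EuclideanSpace ℝ (Fin n))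
    (z : EuclideanSpace ℝ (Fin n)) :
    ‖T z‖ ^ 2 = ∑ k, ⟪z, T.adjoint (EuclideanSpace.single k 1)⟫ ^ 2 := by
  rw [EuclideanSpace.norm_sq_eq]
  refine Finset.sum_congr rfl fun k _ => ?_
  rw [ContinuousLinearMap.adjoint_inner_right]
  simp [EuclideanSpace.inner_single_right]

lemma sum_norm_sq_of_decomposition
    (hx : ∀ v : EuclideanSpace ℝ (Fin n), ∑ j, ⟪x j, v⟫ • x j = v)
    (T : EuclideanSpace ℝ (Fin n) →L[ℝ] EuclideanSpace ℝ (Fin n)) :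
    ∑ j, ‖T (x j)‖ ^ 2 = hsNormSq T := by
  simp only [norm_sq_eq_sum_inner_adjoint]
  rw [Finset.sum_comm]
  simp only [sum_inner_sq_of_decomposition hx]
  exact hsNormSq_adjoint T

lemma hsNormSq_nonneg (T : EuclideanSpace ℝ (Fin n) →L[ℝ] EuclideanSpace ℝ (Fin n)) :
    0 ≤ hsNormSq T :=
  Finset.sum_nonneg fun _ _ => sq_nonneg _

lemma norm_le_sqrt_hsNormSq (T : EuclideanSpace ℝ (Fin n) →L[ℝ] EuclideanSpace ℝ (Fin n)) :
    ‖T‖ ≤ Real.sqrt (hsNormSq T) := by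
  refine T.opNorm_le_bound (Real.sqrt_nonneg _) fun z => ?_
  refine abs_le_of_sq_le_sq' ?_ (by positivity) |>.2
  rw [mul_pow, Real.sq_sqrt (hsNormSq_nonneg T), ← hsNormSq_adjoint, hsNormSq,
    norm_sq_eq_sum_inner_adjoint, Finset.sum_mul]
  refine Finset.sum_le_sum fun k _ => ?_
  rw [← mul_pow, mul_comm, ← sq_abs]
  exact pow_le_pow_left₀ (abs_nonneg _) (abs_real_inner_le_norm _ _) 2

end Decomposition

/-- main extraction theorem. There is an absolute constant `c > 0`
and for every `ε ∈ (0,1)` a constant `C(ε) > 0` such that for every decomposition of the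
identity `(x j)_{j ≤ m}` on `ℝⁿ` and every norm-one operator `T` there is a subset `σ`
with `|σ| ≥ (1-ε)‖T‖_HS²` on which `(T x j)` is `C(ε)`-equivalent to an orthogonal basis
and `‖T x j‖ ≥ c √ε (‖T‖_HS/√n) ‖x j‖`. -/
theorem john_decomposition_selection :
    ∃ c : ℝ, 0 < c ∧ ∀ ε : ℝ, ε ∈ Set.Ioo (0 : ℝ) 1 → ∃ C : ℝ, 0 < C ∧
      ∀ (n m : ℕ), 0 < n → 0 < m →
      ∀ x : Fin m → EuclideanSpace ℝ (Fin n),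
      (∀ v : EuclideanSpace ℝ (Fin n), ∑ j, ⟪x j, v⟫ • x j = v) →
      ∀ T : EuclideanSpace ℝ (Fin n) →L[ℝ] EuclideanSpace ℝ (Fin n), ‖T‖ = 1 →
      ∃ σ : Finset (Fin m),
        (1 - ε) * hsNormSq T ≤ σ.card ∧
        IsEquivToOrthogonalBasis C σ (fun j => T (x j)) ∧
        ∀ j ∈ σ,
          c * Real.sqrt ε * (Real.sqrt (hsNormSq T) / Real.sqrt n) * ‖x j‖ ≤ ‖T (x j)‖ := by
  refine ⟨1 / 2, by norm_num, fun ε hε => ?_⟩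
  obtain ⟨hε0, hε1⟩ := hε
  set e := ε / 2 with he
  have he0 : 0 < e := by positivity
  set lo := (Real.exp (24 / e))⁻¹ * (e ^ 2 / 16)
  set up := Real.exp 3 * (400 / e ^ 2)
  have hlo : 0 < lo := by positivity
  have hup : 0 < up := by positivity
  refine ⟨(Real.sqrt lo)⁻¹ * Real.sqrt up, by positivity, ?_⟩
  intro n m hn _ x hx T hT
  have hn0 : (0 : ℝ) < n := by exact_mod_cast hn
  set H := hsNormSq T with hH
  have hH1 : 1 ≤ H := by
    have := norm_le_sqrt_hsNormSq T
    rwa [hT, Real.one_le_sqrt] at this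
  set c := 1 / 2 * Real.sqrt ε * (Real.sqrt H / Real.sqrt n) with hc
  have hc2 : c ^ 2 * n = ε / 4 * H := by
    rw [hc, mul_pow, mul_pow, div_pow (Real.sqrt H), Real.sq_sqrt hε0.le, Real.sq_sqrt (by linarith),
      Real.sq_sqrt hn0.le]
    field_simp
    ring
  have hc0 : 0 ≤ c := by positivity
  have hxn : ∑ j, ‖x j‖ ^ 2 = n := by
    have := sum_norm_sq_of_decomposition hx (ContinuousLinearMap.id ℝ _)
    simpa [hsNormSq] using this
  have hTx := sum_norm_sq_of_decomposition hx T
  set J : Finset (Fin m) := Finset.univ.filter fun j => T (x j) ≠ 0 ∧ c * ‖x j‖ ≤ ‖T (x j)‖ with hJ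
  set h := ∑ j ∈ J, ‖T (x j)‖ ^ 2 with hh
  have hhH : (1 - e) * H ≤ h := by
    have h1 : ∑ j ∈ Finset.univ \ J, ‖T (x j)‖ ^ 2 ≤ c ^ 2 * n := by
      rw [← hxn, Finset.mul_sum]
      calc ∑ j ∈ Finset.univ \ J, ‖T (x j)‖ ^ 2
          ≤ ∑ j ∈ Finset.univ \ J, c ^ 2 * ‖x j‖ ^ 2 := by
            refine Finset.sum_le_sum fun j hj => ?_
            rw [← mul_pow]
            refine pow_le_pow_left₀ (norm_nonneg _) ?_ 2
            by_contra! hlt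
            have : T (x j) ≠ 0 := norm_pos_iff.1 (lt_of_le_of_lt (by positivity) hlt)
            simp [hJ, this, hlt.le] at hj
        _ ≤ ∑ j, c ^ 2 * ‖x j‖ ^ 2 :=
            Finset.sum_le_sum_of_subset_of_nonneg (Finset.subset_univ _) fun _ _ _ => by positivity
    have h2 := Finset.sum_sdiff (f := fun j => ‖T (x j)‖ ^ 2) (Finset.subset_univ J)
    rw [hTx] at h2
    have h3 : 0 ≤ ε * H := by positivity
    rw [he]
    linarith
  have hTJ : ∀ j ∈ J, ‖T (x j)‖ ≠ 0 := fun j hj =>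
    norm_ne_zero_iff.2 (Finset.mem_filter.1 hj).2.1
  obtain ⟨σ, hσJ, hcard, hσ⟩ := exists_riesz_subset (J := J)
    (v := fun j => ‖T (x j)‖⁻¹ • T (x j)) (p := fun j => ‖T (x j)‖ ^ 2) he0 (by linarith)
    (fun j hj => norm_smul_inv_norm (norm_ne_zero_iff.1 (hTJ j hj))) (fun j _ => sq_nonneg _)
    (fun z => by
      have h1 : ∀ j ∈ J, ‖T (x j)‖ ^ 2 * ⟪‖T (x j)‖⁻¹ • T (x j), z⟫ ^ 2
          = ⟪x j, T.adjoint z⟫ ^ 2 := fun j hj => by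
        rw [inner_smul_left, conj_trivial, ContinuousLinearMap.adjoint_inner_right, mul_pow,
          inv_pow, mul_inv_cancel_left₀ (pow_ne_zero 2 (hTJ j hj))]
      rw [Finset.sum_congr rfl h1]
      calc ∑ j ∈ J, ⟪x j, T.adjoint z⟫ ^ 2 ≤ ∑ j, ⟪x j, T.adjoint z⟫ ^ 2 :=
            Finset.sum_le_sum_of_subset_of_nonneg (Finset.subset_univ _) fun _ _ _ => sq_nonneg _
        _ = ‖T.adjoint z‖ ^ 2 := sum_inner_sq_of_decomposition hx _
        _ ≤ ‖z‖ ^ 2 := by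
            refine pow_le_pow_left₀ (norm_nonneg _) ?_ 2
            have h2 := T.adjoint.le_opNorm z
            rwa [LinearIsometryEquiv.norm_map, hT, one_mul] at h2)
    rfl (by rw [← hh]; nlinarith)
  refine ⟨σ, ?_, ?_, fun j hj => (Finset.mem_filter.1 (hσJ hj)).2.2⟩
  · refine le_trans ?_ hcard
    have h1 : (1 - e) * ((1 - e) * H) ≤ (1 - e) * h :=
      mul_le_mul_of_nonneg_left hhH (by linarith)
    have h2 : (1 - ε) * H ≤ (1 - e) * ((1 - e) * H) := by
      have : 0 ≤ e ^ 2 * H := by positivity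
      rw [show ε = 2 * e by rw [he]; ring]
      linarith
    exact h2.trans h1
  · refine ⟨fun j => ‖T (x j)‖⁻¹, (Real.sqrt lo)⁻¹, Real.sqrt up,
      fun j hj => inv_ne_zero (hTJ j (hσJ hj)), by positivity, by positivity, le_rfl, fun a => ?_⟩
    obtain ⟨h1, h2⟩ := hσ a
    simp only [smul_smul] at h1 h2
    rw [inv_inv, ← Real.sqrt_mul hlo.le, ← Real.sqrt_mul hup.le]
    exact ⟨Real.sqrt_le_iff.2 ⟨norm_nonneg _, h1⟩, Real.le_sqrt_of_sq_le h2⟩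
end

section
/- There is an absolute constant c > 0 and a function C : (0,1) → (0,∞) with the following property. Let n, m be positive integers, let (x_j)_{j=1}^m be a decomposition of the identity on the euclidean space ℝⁿ, let T : ℝⁿ → ℝⁿ be a linear operator with ‖T‖ = 1, and set h = ‖T‖_HS². Then for every positive integer κ < h there exists a subset σ ⊆ {1,…,m} with |σ| = κ such that: (i) the system (T x_j)_{j∈σ} is C(κ/h)-equivalent to an orthogonal basis in Hilbert space; and (ii) ‖T x_j‖₂ ≥ c √((h−κ)/n) ‖x_j‖₂ for every j ∈ σ. -/
open scoped RealInnerProductSpace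

/-! ### Resolvents of symmetric operators -/

section Resolvent

variable {E : Type*} [NormedAddCommGroup E] [InnerProductSpace ℝ E]

/-- `N` is a right inverse of `A - β`. -/
def IsResolvent (A : E →ₗ[ℝ] E) (β : ℝ) (N : E →ₗ[ℝ] E) : Prop :=
  ∀ x : E, A (N x) - β • N x = x

theorem exists_isResolvent [FiniteDimensional ℝ E] {A : E →ₗ[ℝ] E} {β : ℝ}
    (h : ∀ v, A v = β • v → v = 0) : ∃ N, IsResolvent A β N := by
  have hinj : Function.Injective (A - β • (LinearMap.id : E →ₗ[ℝ] E)) := by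
    rw [← LinearMap.ker_eq_bot, LinearMap.ker_eq_bot']
    intro v hv
    exact h v (sub_eq_zero.1 (by simpa using hv))
  refine ⟨(LinearEquiv.ofInjectiveEndo _ hinj).symm.toLinearMap, fun x => ?_⟩
  exact (LinearEquiv.ofInjectiveEndo _ hinj).apply_symm_apply x

variable {A N N' : E →ₗ[ℝ] E} {β β' : ℝ}

theorem IsResolvent.inner_comm (hN : IsResolvent A β N) (hA : A.IsSymmetric) (x y : E) :
    ⟪N x, y⟫ = ⟪x, N y⟫ := by
  have h1 : ⟪A (N x) - β • N x, N y⟫ = ⟪N x, A (N y) - β • N y⟫ := by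
    rw [inner_sub_left, inner_sub_right, hA, real_inner_smul_left, real_inner_smul_right]
  rw [hN, hN] at h1
  exact h1.symm

theorem IsResolvent.left_inverse (hN : IsResolvent A β N) (hA : A.IsSymmetric) (x : E) :
    N (A x - β • x) = x := by
  refine ext_inner_right ℝ fun y => ?_
  rw [hN.inner_comm hA, inner_sub_left, hA, real_inner_smul_left, ← real_inner_smul_right,
    ← inner_sub_right, hN]

/-- Second-order resolvent identity for the quadratic forms of two resolvents. -/
theorem IsResolvent.inner_sub_inner (hN : IsResolvent A β N) (hN' : IsResolvent A β' N')
    (hA : A.IsSymmetric) (y : E) :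
    ⟪N y, y⟫ - ⟪N' y, y⟫ =
      (β - β') * ‖N' y‖ ^ 2 + (β - β') ^ 2 * ⟪N (N' y), N' y⟫ := by
  set z := N' y with hz
  have hy : y = (A z - β • z) + (β - β') • z := by
    rw [← hN' y, ← hz]; module
  have h1 : N y = z + (β - β') • N z := by
    conv_lhs => rw [hy]
    rw [map_add, hN.left_inverse hA, map_smul]
  have h2 : ⟪N z, y⟫ = ‖z‖ ^ 2 + (β - β') * ⟪N z, z⟫ := by
    conv_lhs => rw [hy]
    rw [inner_add_right, hN.inner_comm hA, hN.left_inverse hA, real_inner_self_eq_norm_sq,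
      real_inner_smul_right]
  rw [h1, inner_add_left, real_inner_smul_left, h2]
  ring

/-- Sherman–Morrison formula. -/
theorem IsResolvent.rankOneUpdate (hN : IsResolvent A β N) (hA : A.IsSymmetric) (w : E)
    (hw : 1 + ⟪N w, w⟫ ≠ 0) :
    IsResolvent (A + (innerₛₗ ℝ w).smulRight w) β
      (N - (1 + ⟪N w, w⟫)⁻¹ • (innerₛₗ ℝ (N w)).smulRight (N w)) := by
  intro x
  simp only [LinearMap.add_apply, LinearMap.sub_apply, LinearMap.smul_apply,
    LinearMap.smulRight_apply, innerₛₗ_apply_apply, map_sub, map_smul]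
  have h1 : A (N x) = x + β • N x := eq_add_of_sub_eq (hN x)
  have h2 : A (N w) = w + β • N w := eq_add_of_sub_eq (hN w)
  have h3 : ⟪w, N x⟫ - (1 + ⟪N w, w⟫)⁻¹ * ⟪w, N x⟫ * (1 + ⟪N w, w⟫) = 0 := by
    field_simp
    ring
  rw [h1, h2, hN.inner_comm hA w x]
  rw [real_inner_comm w (N w)] at h3 ⊢
  linear_combination (norm := module) h3 • w

theorem IsResolvent.sum_inner_rankOneUpdate {ι : Type*} [Fintype ι] (y : ι → E) (w : E) (c : ℝ) :
    ∑ j, ⟪(N - c • (innerₛₗ ℝ (N w)).smulRight (N w)) (y j), y j⟫ =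
      ∑ j, ⟪N (y j), y j⟫ - c * ∑ j, ⟪y j, N w⟫ ^ 2 := by
  rw [Finset.mul_sum, ← Finset.sum_sub_distrib]
  refine Finset.sum_congr rfl fun j _ => ?_
  simp only [LinearMap.sub_apply, LinearMap.smul_apply,
    LinearMap.smulRight_apply, innerₛₗ_apply_apply, inner_sub_left, real_inner_smul_left]
  rw [real_inner_comm (y j) (N w)]
  ring

end Resolvent

/-! ### The upper barrier -/

section Upper

variable {E : Type*} [NormedAddCommGroup E] [InnerProductSpace ℝ E]
  {A N N' : E →ₗ[ℝ] E} {u : ℝ}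

theorem inner_resolvent_nonpos (hu : ∀ v, ⟪A v, v⟫ ≤ u * ‖v‖ ^ 2) (hN : IsResolvent A u N)
    (y : E) : ⟪N y, y⟫ ≤ 0 := by
  have h1 : ⟪N y, A (N y) - u • N y⟫ ≤ 0 := by
    rw [inner_sub_right, real_inner_smul_right, real_inner_self_eq_norm_sq, real_inner_comm]
    linarith [hu (N y)]
  rwa [hN y] at h1

theorem inner_resolvent_neg {t : ℝ} (ht : 0 < t) (hu : ∀ v, ⟪A v, v⟫ ≤ u * ‖v‖ ^ 2)
    (hN : IsResolvent A (u + t) N) {y : E} (hy : y ≠ 0) : ⟪N y, y⟫ < 0 := by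
  have hz : N y ≠ 0 := fun h => hy (by rw [← hN y, h]; simp)
  have h1 : ⟪N y, A (N y) - (u + t) • N y⟫ < 0 := by
    rw [inner_sub_right, real_inner_smul_right, real_inner_self_eq_norm_sq, real_inner_comm]
    have := hu (N y)
    have : 0 < t * ‖N y‖ ^ 2 := by positivity
    linarith
  rwa [hN y] at h1

theorem exists_isResolvent_above [FiniteDimensional ℝ E] {t : ℝ} (ht : 0 < t)
    (hu : ∀ v, ⟪A v, v⟫ ≤ u * ‖v‖ ^ 2) : ∃ N, IsResolvent A (u + t) N := by
  refine exists_isResolvent fun v hv => ?_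
  have h := hu v
  rw [hv, real_inner_smul_left, real_inner_self_eq_norm_sq] at h
  have h2 : ‖v‖ ^ 2 ≤ 0 := by nlinarith
  simpa using h2

theorem upper_bound_rankOneUpdate (hA : A.IsSymmetric) (hu : ∀ v, ⟪A v, v⟫ ≤ u * ‖v‖ ^ 2)
    (hN : IsResolvent A u N) (w : E) (hw : 0 ≤ 1 + ⟪N w, w⟫) (v : E) :
    ⟪(A + (innerₛₗ ℝ w).smulRight w) v, v⟫ ≤ u * ‖v‖ ^ 2 := by
  have h := hu (v + ⟪w, v⟫ • N w)
  have h2 : A (N w) = w + u • N w := eq_add_of_sub_eq (hN w)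
  have h3 : ⟪A v, N w⟫ = ⟪w, v⟫ + u * ⟪v, N w⟫ := by
    rw [hA, h2, inner_add_right, real_inner_smul_right, real_inner_comm]
  rw [← real_inner_self_eq_norm_sq] at h
  simp only [map_add, map_smul, h2, inner_add_left, inner_add_right, real_inner_smul_left,
    real_inner_smul_right, h3, real_inner_comm v (N w)] at h
  simp only [LinearMap.add_apply, LinearMap.smulRight_apply, innerₛₗ_apply_apply,
    inner_add_left, real_inner_smul_left]
  rw [← real_inner_self_eq_norm_sq]
  rw [real_inner_comm w (N w)] at hw
  nlinarith [mul_nonneg (sq_nonneg ⟪w, v⟫) hw, real_inner_comm v (N w)]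

/-- Averaged cost of a rank-one update for the upper barrier. -/
theorem upper_average {ι : Type*} [Fintype ι] {y : ι → E} (hA : A.IsSymmetric)
    (hR : ∀ z, ∑ j, ⟪y j, z⟫ ^ 2 ≤ ‖z‖ ^ 2)
    (hu : ∀ v, ⟪A v, v⟫ ≤ u * ‖v‖ ^ 2) (hN : IsResolvent A u N)
    (hN' : IsResolvent A (u + 1) N') (hpot : -1 ≤ ∑ j, ⟪N (y j), y j⟫) :
    ∑ j, ‖N' (y j)‖ ^ 2 ≤ ∑ i, ⟪N' (y i), y i⟫ - ∑ i, ⟪N (y i), y i⟫ ∧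
    ∑ j, ((∑ i, ⟪y i, N' (y j)⟫ ^ 2) /
      (∑ i, ⟪N' (y i), y i⟫ - ∑ i, ⟪N (y i), y i⟫) - ⟪N' (y j), y j⟫) ≤ 2 := by
  set D := ∑ i, ⟪N' (y i), y i⟫ - ∑ i, ⟪N (y i), y i⟫ with hD
  have h1 : ∑ j, ‖N' (y j)‖ ^ 2 ≤ D := by
    rw [hD, ← Finset.sum_sub_distrib]
    refine Finset.sum_le_sum fun j _ => ?_
    have h := hN.inner_sub_inner hN' hA (y j)
    have h' := inner_resolvent_nonpos hu hN (N' (y j))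
    have h2 : (u - (u + 1)) = -1 := by ring
    rw [h2] at h
    linarith
  refine ⟨h1, ?_⟩
  have h0 : 0 ≤ D := le_trans (by positivity) h1
  have h2 : (∑ j, ∑ i, ⟪y i, N' (y j)⟫ ^ 2) / D ≤ 1 :=
    div_le_one_of_le₀ ((Finset.sum_le_sum fun j _ => hR _).trans h1) h0
  rw [Finset.sum_sub_distrib, ← Finset.sum_div]
  linarith

end Upper

/-! ### The lower barrier -/

section Lower

variable {E : Type*} [NormedAddCommGroup E] [InnerProductSpace ℝ E]
  {A N N' : E →ₗ[ℝ] E} {V : Submodule ℝ E} {b β : ℝ}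

theorem resolvent_mem (hAV : ∀ x, A x ∈ V) (hβ : β ≠ 0) (hN : IsResolvent A β N) {z : E}
    (hz : z ∈ V) : N z ∈ V := by
  have h1 : N z = β⁻¹ • (A (N z) - z) := by
    have h : A (N z) - z = β • N z := by
      rw [sub_eq_iff_eq_add, ← sub_eq_iff_eq_add']
      exact hN z
    rw [h, smul_smul, inv_mul_cancel₀ hβ, one_smul]
  rw [h1]
  exact V.smul_mem _ (V.sub_mem (hAV _) hz)

theorem inner_resolvent_nonneg (hAV : ∀ x, A x ∈ V) (hb : ∀ x ∈ V, b * ‖x‖ ^ 2 ≤ ⟪A x, x⟫)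
    (hβ : β ≠ 0) (hβb : β ≤ b) (hN : IsResolvent A β N) {z : E} (hz : z ∈ V) :
    0 ≤ ⟪N z, z⟫ := by
  have h1 : 0 ≤ ⟪N z, A (N z) - β • N z⟫ := by
    rw [inner_sub_right, real_inner_smul_right, real_inner_self_eq_norm_sq, real_inner_comm]
    have := hb _ (resolvent_mem hAV hβ hN hz)
    nlinarith [mul_le_mul_of_nonneg_right hβb (sq_nonneg ‖N z‖)]
  rwa [hN z] at h1

theorem resolvent_apply_of_mem_orthogonal (hA : A.IsSymmetric) (hAV : ∀ x, A x ∈ V) (hβ : β ≠ 0)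
    (hN : IsResolvent A β N) {z : E} (hz : z ∈ Vᗮ) : N z = -β⁻¹ • z := by
  have h0 : A z = 0 := by
    refine ext_inner_right ℝ fun y => ?_
    rw [hA, inner_zero_left]
    exact V.inner_left_of_mem_orthogonal (hAV y) hz
  have h := hN.left_inverse hA z
  rw [h0, zero_sub, map_neg, map_smul] at h
  conv_rhs => rw [← h]
  rw [smul_neg, neg_smul, neg_neg, inv_smul_smul₀ hβ]

theorem exists_isResolvent_below [FiniteDimensional ℝ E] (hAV : ∀ x, A x ∈ V)
    (hb : ∀ x ∈ V, b * ‖x‖ ^ 2 ≤ ⟪A x, x⟫) (hβ : 0 < β) (hβb : β < b) :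
    ∃ N, IsResolvent A β N := by
  refine exists_isResolvent fun v hv => ?_
  have hvV : v ∈ V := by
    have h : v = β⁻¹ • A v := by rw [hv, smul_smul, inv_mul_cancel₀ hβ.ne', one_smul]
    rw [h]
    exact V.smul_mem _ (hAV v)
  have h := hb v hvV
  rw [hv, real_inner_smul_left, real_inner_self_eq_norm_sq] at h
  have h2 : ‖v‖ ^ 2 ≤ 0 := by nlinarith
  simpa using h2

variable [V.HasOrthogonalProjection]

theorem neg_le_inner_resolvent (hA : A.IsSymmetric) (hAV : ∀ x, A x ∈ V)
    (hb : ∀ x ∈ V, b * ‖x‖ ^ 2 ≤ ⟪A x, x⟫) (hβ : β ≠ 0) (hβb : β ≤ b)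
    (hN : IsResolvent A β N) (z : E) :
    -β⁻¹ * ‖z - V.starProjection z‖ ^ 2 ≤ ⟪N z, z⟫ := by
  set p := V.starProjection z with hp
  set q := z - p with hq
  have hpV : p ∈ V := V.starProjection_apply_mem z
  have hqV : q ∈ Vᗮ := V.sub_starProjection_mem_orthogonal z
  have hz : z = p + q := by rw [hq]; abel
  have h1 : ⟪N p, q⟫ = 0 :=
    V.inner_right_of_mem_orthogonal (resolvent_mem hAV hβ hN hpV) hqV
  have h2 : ⟪q, p⟫ = 0 := V.inner_left_of_mem_orthogonal hpV hqV
  have h3 := inner_resolvent_nonneg hAV hb hβ hβb hN hpV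
  rw [hz, map_add, resolvent_apply_of_mem_orthogonal hA hAV hβ hN hqV, inner_add_left,
    inner_add_right, inner_add_right, real_inner_smul_left, real_inner_smul_left, h1, h2,
    real_inner_self_eq_norm_sq]
  linarith

theorem resolvent_sub_starProjection (hA : A.IsSymmetric) (hAV : ∀ x, A x ∈ V) (hβ : β ≠ 0)
    (hN : IsResolvent A β N) (y : E) :
    N y - V.starProjection (N y) = -β⁻¹ • (y - V.starProjection y) := by
  have hqV := V.sub_starProjection_mem_orthogonal y
  have hy : N y = N (V.starProjection y) + -β⁻¹ • (y - V.starProjection y) := by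
    rw [← resolvent_apply_of_mem_orthogonal hA hAV hβ hN hqV, ← map_add]
    congr 1
    abel
  have h1 : V.starProjection (N y) = N (V.starProjection y) :=
    Submodule.eq_starProjection_of_mem_orthogonal'
      (resolvent_mem hAV hβ hN (V.starProjection_apply_mem y)) (Vᗮ.smul_mem _ hqV) hy
  rw [h1, hy]
  abel

/-- Lower bounds for the decrease of the lower potential under a shift of the barrier. -/
theorem resolvent_gap (hA : A.IsSymmetric) (hAV : ∀ x, A x ∈ V)
    (hb : ∀ x ∈ V, b * ‖x‖ ^ 2 ≤ ⟪A x, x⟫) (hβ : 0 < β) (hβb : β < b)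
    (hN : IsResolvent A b N) (hN' : IsResolvent A β N') (y : E) :
    (b - β) * ‖N' y‖ ^ 2 - (b - β) ^ 2 / (b * β ^ 2) * ‖y - V.starProjection y‖ ^ 2
        ≤ ⟪N y, y⟫ - ⟪N' y, y⟫ ∧
      (b - β) / (b * β) * ‖y - V.starProjection y‖ ^ 2 ≤ ⟪N y, y⟫ - ⟪N' y, y⟫ := by
  have hb0 : 0 < b := hβ.trans hβb
  have h1 := hN.inner_sub_inner hN' hA y
  have h2 := neg_le_inner_resolvent hA hAV hb hb0.ne' le_rfl hN (N' y)
  have h3 : ‖N' y - V.starProjection (N' y)‖ ^ 2 = (β ^ 2)⁻¹ * ‖y - V.starProjection y‖ ^ 2 := by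
    rw [resolvent_sub_starProjection hA hAV hβ.ne' hN', norm_smul, mul_pow]
    simp
  have h4 : ‖N' y - V.starProjection (N' y)‖ ^ 2 ≤ ‖N' y‖ ^ 2 := by
    have := V.norm_sq_eq_add_norm_sq_starProjection (N' y)
    rw [Submodule.starProjection_orthogonal_val] at this
    nlinarith [sq_nonneg ‖V.starProjection (N' y)‖]
  rw [h3] at h2 h4
  set Q := ‖y - V.starProjection y‖ ^ 2
  have h5 := mul_le_mul_of_nonneg_left h2 (sq_nonneg (b - β))
  have h6 := mul_le_mul_of_nonneg_left h4 (sub_pos.2 hβb).le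
  have h7 : (b - β) ^ 2 * (-b⁻¹ * ((β ^ 2)⁻¹ * Q)) = -((b - β) ^ 2 / (b * β ^ 2) * Q) := by
    field_simp
  have h8 : (b - β) / (b * β) * Q =
      (b - β) * ((β ^ 2)⁻¹ * Q) - (b - β) ^ 2 / (b * β ^ 2) * Q := by
    field_simp
    ring
  constructor <;> linarith

theorem sum_norm_sq_starProjection_le {ι : Type*} [Fintype ι] {y : ι → E} [FiniteDimensional ℝ V]
    (hR : ∀ z, ∑ j, ⟪y j, z⟫ ^ 2 ≤ ‖z‖ ^ 2) :
    ∑ j, ‖V.starProjection (y j)‖ ^ 2 ≤ Module.finrank ℝ V := by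
  let e := stdOrthonormalBasis ℝ V
  have h1 : ∀ x, ‖V.starProjection x‖ ^ 2 = ∑ i, ⟪x, (e i : E)⟫ ^ 2 := fun x => by
    have h := e.sum_sq_norm_inner_right ⟨V.starProjection x, V.starProjection_apply_mem x⟩
    rw [Submodule.coe_norm] at h
    rw [← h]
    refine Finset.sum_congr rfl fun i _ => ?_
    rw [Submodule.coe_inner, Real.norm_eq_abs, sq_abs, ← Submodule.inner_starProjection_left_eq_right,
      Submodule.starProjection_eq_self_iff.2 (e i).2, real_inner_comm]
  simp_rw [h1]
  rw [Finset.sum_comm]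
  calc ∑ i, ∑ j, ⟪y j, (e i : E)⟫ ^ 2 ≤ ∑ i, (1 : ℝ) := by
        refine Finset.sum_le_sum fun i _ => (hR _).trans ?_
        have : ‖(e i : E)‖ = 1 := e.orthonormal.1 i
        rw [this, one_pow]
    _ = _ := by simp

/-- Averaged gain of a rank-one update for the lower barrier. -/
theorem lower_average {ι : Type*} [Fintype ι] {y : ι → E} [FiniteDimensional ℝ V]
    (hA : A.IsSymmetric) (hAV : ∀ x, A x ∈ V)
    (hb : ∀ x ∈ V, b * ‖x‖ ^ 2 ≤ ⟪A x, x⟫) (hR : ∀ z, ∑ j, ⟪y j, z⟫ ^ 2 ≤ ‖z‖ ^ 2)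
    (hβ : 0 < β) (hβb : β < b) (hN : IsResolvent A b N) (hN' : IsResolvent A β N')
    (hdim : b ≤ (b - β) * (∑ j, ‖y j‖ ^ 2 - Module.finrank ℝ V))
    (hpot : ∑ j, ⟪N (y j), y j⟫ ≤ -(2 + (b - β)⁻¹)) :
    0 < ∑ i, ⟪N (y i), y i⟫ - ∑ i, ⟪N' (y i), y i⟫ ∧
    2 ≤ ∑ j, (-⟪N' (y j), y j⟫ - (∑ i, ⟪y i, N' (y j)⟫ ^ 2) /
      (∑ i, ⟪N (y i), y i⟫ - ∑ i, ⟪N' (y i), y i⟫)) := by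
  have hb0 : 0 < b := hβ.trans hβb
  set δ := b - β with hδ
  have hδ0 : 0 < δ := sub_pos.2 hβb
  set D := ∑ i, ⟪N (y i), y i⟫ - ∑ i, ⟪N' (y i), y i⟫ with hD
  set q := ∑ j, ‖y j - V.starProjection (y j)‖ ^ 2 with hq
  have hqh : b ≤ δ * q := by
    refine hdim.trans (mul_le_mul_of_nonneg_left ?_ hδ0.le)
    have h1 := sum_norm_sq_starProjection_le (V := V) hR
    have h2 : ∑ j, ‖y j‖ ^ 2 = ∑ j, ‖V.starProjection (y j)‖ ^ 2 + q := by
      rw [hq, ← Finset.sum_add_distrib]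
      refine Finset.sum_congr rfl fun j _ => ?_
      rw [V.norm_sq_eq_add_norm_sq_starProjection (y j), Submodule.starProjection_orthogonal_val]
    linarith
  have hD1 : δ * ∑ j, ‖N' (y j)‖ ^ 2 - δ ^ 2 / (b * β ^ 2) * q ≤ D := by
    rw [hD, hq, ← Finset.sum_sub_distrib, Finset.mul_sum, Finset.mul_sum,
      ← Finset.sum_sub_distrib]
    exact Finset.sum_le_sum fun j _ => (resolvent_gap hA hAV hb hβ hβb hN hN' (y j)).1
  have hD2 : δ / (b * β) * q ≤ D := by
    rw [hD, hq, ← Finset.sum_sub_distrib, Finset.mul_sum]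
    exact Finset.sum_le_sum fun j _ => (resolvent_gap hA hAV hb hβ hβb hN hN' (y j)).2
  have hq0 : 0 < q := by
    by_contra h
    nlinarith
  have hD0 : 0 < D := lt_of_lt_of_le (by positivity) hD2
  refine ⟨hD0, ?_⟩
  have hsq : δ / (b * β ^ 2) * q ≤ D ^ 2 := by
    calc δ / (b * β ^ 2) * q ≤ (δ / (b * β ^ 2) * q) * (δ * q / b) :=
          le_mul_of_one_le_right (by positivity) ((one_le_div hb0).2 hqh)
      _ = (δ / (b * β) * q) ^ 2 := by
          field_simp
      _ ≤ D ^ 2 := pow_le_pow_left₀ (by positivity) hD2 2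
  have hr : (∑ j, ∑ i, ⟪y i, N' (y j)⟫ ^ 2) / D ≤ δ⁻¹ + D := by
    rw [div_le_iff₀ hD0]
    have h1 : ∑ j, ∑ i, ⟪y i, N' (y j)⟫ ^ 2 ≤ ∑ j, ‖N' (y j)‖ ^ 2 :=
      Finset.sum_le_sum fun j _ => hR _
    refine h1.trans (le_of_mul_le_mul_left ?_ hδ0)
    have h2 : δ * (δ / (b * β ^ 2) * q) ≤ δ * D ^ 2 := mul_le_mul_of_nonneg_left hsq hδ0.le
    have h3 : δ * ((δ⁻¹ + D) * D) = D + δ * D ^ 2 := by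
      field_simp
    rw [h3]
    have h4 : δ * (δ / (b * β ^ 2) * q) = δ ^ 2 / (b * β ^ 2) * q := by ring
    linarith
  rw [Finset.sum_sub_distrib, ← Finset.sum_div, Finset.sum_neg_distrib]
  linarith

end Lower

/-! ### Frame operators and the selection step -/

theorem exists_le_of_sum_le_of_support {ι : Type*} [Fintype ι] {P : ι → Prop} {f g : ι → ℝ}
    (hf : ∀ j, ¬P j → f j = 0) (hg : ∀ j, ¬P j → g j = 0) (hg0 : 0 < ∑ j, g j)
    (hfg : ∑ j, f j ≤ ∑ j, g j) : ∃ j, P j ∧ f j ≤ g j := by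
  by_contra! H
  obtain ⟨j, -, hj⟩ := Finset.exists_ne_zero_of_sum_ne_zero hg0.ne'
  refine hfg.not_gt (Finset.sum_lt_sum (fun i _ => ?_)
    ⟨j, Finset.mem_univ j, H j (not_imp_comm.1 (hg j) hj)⟩)
  by_cases h : P i
  · exact (H i h).le
  · rw [hf i h, hg i h]

section Frame

variable {E : Type*} [NormedAddCommGroup E] [InnerProductSpace ℝ E] {ι : Type*}

/-- The operator `∑ j ∈ σ, w j ⊗ w j`. -/
noncomputable def frameOp (σ : Finset ι) (w : ι → E) : E →ₗ[ℝ] E :=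
  ∑ j ∈ σ, (innerₛₗ ℝ (w j)).smulRight (w j)

variable {σ : Finset ι} {w : ι → E}

theorem frameOp_apply (v : E) : frameOp σ w v = ∑ j ∈ σ, ⟪w j, v⟫ • w j := by
  simp [frameOp]

theorem inner_frameOp (v z : E) : ⟪frameOp σ w v, z⟫ = ∑ j ∈ σ, ⟪w j, v⟫ * ⟪w j, z⟫ := by
  simp [frameOp_apply, sum_inner, real_inner_smul_left]

theorem frameOp_isSymmetric : (frameOp σ w).IsSymmetric := fun v z => by
  rw [inner_frameOp, real_inner_comm, inner_frameOp]
  exact Finset.sum_congr rfl fun j _ => mul_comm _ _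

theorem frameOp_mem_span (v : E) : frameOp σ w v ∈ Submodule.span ℝ (w '' σ) := by
  rw [frameOp_apply]
  exact Submodule.sum_mem _ fun j hj =>
    Submodule.smul_mem _ _ (Submodule.subset_span ⟨j, hj, rfl⟩)

theorem norm_sq_sum_smul (a : ι → ℝ) :
    ‖∑ j ∈ σ, a j • w j‖ ^ 2 = ∑ j ∈ σ, a j * ⟪w j, ∑ i ∈ σ, a i • w i⟫ := by
  rw [← real_inner_self_eq_norm_sq]
  nth_rewrite 1 [sum_inner]
  simp_rw [real_inner_smul_left]

theorem frameOp_lower_bound {b : ℝ} (hb : 0 ≤ b)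
    (hl : ∀ a : ι → ℝ, b * ∑ j ∈ σ, a j ^ 2 ≤ ‖∑ j ∈ σ, a j • w j‖ ^ 2) {x : E}
    (hx : x ∈ Submodule.span ℝ (w '' σ)) : b * ‖x‖ ^ 2 ≤ ⟪frameOp σ w x, x⟫ := by
  obtain ⟨a, rfl⟩ : ∃ a : ι → ℝ, ∑ j ∈ σ, a j • w j = x :=
    (Submodule.mem_span_image_finset_iff_exists_fun' ℝ).1 hx
  have h1 := hl a
  have h2 := norm_sq_sum_smul (σ := σ) (w := w) a
  set x := ∑ j ∈ σ, a j • w j with hx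
  have h3 := Finset.sum_mul_sq_le_sq_mul_sq σ a (fun j => ⟪w j, x⟫)
  rw [← h2] at h3
  have h4 : ⟪frameOp σ w x, x⟫ = ∑ j ∈ σ, ⟪w j, x⟫ ^ 2 := by
    rw [inner_frameOp]
    exact Finset.sum_congr rfl fun j _ => (sq _).symm
  rw [h4]
  have hS : 0 ≤ ∑ j ∈ σ, ⟪w j, x⟫ ^ 2 := Finset.sum_nonneg fun j _ => sq_nonneg _
  rcases (sq_nonneg ‖x‖).eq_or_lt with h0 | h0
  · rw [← h0, mul_zero]
    exact hS
  · refine le_of_mul_le_mul_left ?_ h0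
    nlinarith [mul_le_mul_of_nonneg_left h3 hb, mul_le_mul_of_nonneg_right h1 hS]

theorem frameOp_upper_bound {u : ℝ} (hu0 : 0 ≤ u) (hu : ∀ v, ⟪frameOp σ w v, v⟫ ≤ u * ‖v‖ ^ 2) (a : ι → ℝ) :
    ‖∑ j ∈ σ, a j • w j‖ ^ 2 ≤ u * ∑ j ∈ σ, a j ^ 2 := by
  have h2 := norm_sq_sum_smul (σ := σ) (w := w) a
  set x := ∑ j ∈ σ, a j • w j with hx
  have h3 := Finset.sum_mul_sq_le_sq_mul_sq σ a (fun j => ⟪w j, x⟫)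
  have h4 := hu x
  simp_rw [inner_frameOp, ← sq] at h4
  rw [← h2] at h3
  have ha : 0 ≤ ∑ j ∈ σ, a j ^ 2 := Finset.sum_nonneg fun j _ => sq_nonneg _
  rcases (sq_nonneg ‖x‖).eq_or_lt with h0 | h0
  · rw [← h0]
    positivity
  · refine le_of_mul_le_mul_left ?_ h0
    nlinarith [mul_le_mul_of_nonneg_left h4 ha]

theorem lower_bound_insert {b β τ : ℝ} {x : E} {N : E →ₗ[ℝ] E} (hβ : 0 < β) (hβb : β ≤ b)
    (hl : ∀ a : ι → ℝ, b * ∑ j ∈ σ, a j ^ 2 ≤ ‖∑ j ∈ σ, a j • w j‖ ^ 2)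
    (hN : IsResolvent (frameOp σ w) β N) (hx : ⟪N x, x⟫ ≤ -1) (a : ι → ℝ) :
    β * (τ ^ 2 + ∑ j ∈ σ, a j ^ 2) ≤ ‖τ • x + ∑ j ∈ σ, a j • w j‖ ^ 2 := by
  set v := N x with hv
  let c : ι → ℝ := fun i => a i + τ * ⟪w i, v⟫
  have h1 : ⟪frameOp σ w v, v⟫ = ∑ j ∈ σ, ⟪w j, v⟫ ^ 2 := by
    rw [inner_frameOp]
    exact Finset.sum_congr rfl fun j _ => (sq _).symm
  have h2 : τ • x + ∑ j ∈ σ, a j • w j = ∑ j ∈ σ, c j • w j - (τ * β) • v := by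
    have : ∑ j ∈ σ, c j • w j = ∑ j ∈ σ, a j • w j + τ • frameOp σ w v := by
      rw [frameOp_apply, Finset.smul_sum, ← Finset.sum_add_distrib]
      refine Finset.sum_congr rfl fun j _ => ?_
      simp only [c]
      module
    rw [this, ← hN x, ← hv]
    module
  have h3 : ∑ j ∈ σ, a j ^ 2 = ∑ j ∈ σ, c j ^ 2 - 2 * τ * ∑ j ∈ σ, c j * ⟪w j, v⟫ +
      τ ^ 2 * ∑ j ∈ σ, ⟪w j, v⟫ ^ 2 := by
    rw [Finset.mul_sum, Finset.mul_sum, ← Finset.sum_sub_distrib, ← Finset.sum_add_distrib]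
    refine Finset.sum_congr rfl fun j _ => ?_
    simp only [c]
    ring
  have h4 : ⟪∑ j ∈ σ, c j • w j, v⟫ = ∑ j ∈ σ, c j * ⟪w j, v⟫ := by
    simp [sum_inner, real_inner_smul_left]
  have h5 : ⟪v, x⟫ = ∑ j ∈ σ, ⟪w j, v⟫ ^ 2 - β * ‖v‖ ^ 2 := by
    rw [← h1, ← real_inner_self_eq_norm_sq, ← real_inner_smul_left, ← inner_sub_left,
      hN x, real_inner_comm]
  have h6 : β * ∑ j ∈ σ, c j ^ 2 ≤ ‖∑ j ∈ σ, c j • w j‖ ^ 2 :=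
    (mul_le_mul_of_nonneg_right hβb (Finset.sum_nonneg fun j _ => sq_nonneg _)).trans (hl c)
  rw [h2, norm_sub_sq_real, real_inner_smul_right, h4, norm_smul, mul_pow, Real.norm_eq_abs,
    sq_abs, h3]
  rw [h5] at hx
  nlinarith [mul_nonneg (mul_nonneg hβ.le (sq_nonneg τ)) (sub_nonneg.2 hx)]

/-- Both barriers and both potentials are controlled for the vectors `s j • y j`, `j ∈ σ`. -/
structure IsBarrierState [Fintype ι] (y : ι → E) (σ : Finset ι) (s : ι → ℝ) (u b p : ℝ) :
    Prop where
  scalar_ne_zero : ∀ j ∈ σ, s j ≠ 0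
  upper : ∀ v, ⟪frameOp σ (fun j => s j • y j) v, v⟫ ≤ u * ‖v‖ ^ 2
  upper_potential : ∃ N, IsResolvent (frameOp σ fun j => s j • y j) u N ∧
    -1 ≤ ∑ j, ⟪N (y j), y j⟫
  lower : ∀ a : ι → ℝ, b * ∑ j ∈ σ, a j ^ 2 ≤ ‖∑ j ∈ σ, a j • s j • y j‖ ^ 2
  lower_potential : ∃ N, IsResolvent (frameOp σ fun j => s j • y j) b N ∧
    ∑ j, ⟪N (y j), y j⟫ ≤ -p

theorem frameOp_insert_update [DecidableEq ι] {j : ι} (hj : j ∉ σ) (y : ι → E) (s : ι → ℝ)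
    (t : ℝ) :
    frameOp (insert j σ) (fun i => Function.update s j t i • y i) =
      frameOp σ (fun i => s i • y i) + (innerₛₗ ℝ (t • y j)).smulRight (t • y j) := by
  rw [frameOp, frameOp, Finset.sum_insert hj, add_comm, Function.update_self]
  congr 1
  refine Finset.sum_congr rfl fun i hi => ?_
  rw [Function.update_of_ne (ne_of_mem_of_not_mem hi hj)]

theorem IsBarrierState.exists_insert [FiniteDimensional ℝ E] [Fintype ι] [DecidableEq ι]
    {y : ι → E} {s : ι → ℝ} {u b p β : ℝ} (hS : IsBarrierState y σ s u b p)
    (hR : ∀ z, ∑ j, ⟪y j, z⟫ ^ 2 ≤ ‖z‖ ^ 2) (hβ : 0 < β) (hβb : β < b)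
    (hp : 2 + (b - β)⁻¹ ≤ p) (hdim : b ≤ (b - β) * (∑ j, ‖y j‖ ^ 2 - σ.card)) :
    ∃ j ∉ σ, ∃ t, IsBarrierState y (insert j σ) (Function.update s j t) (u + 1) β p := by
  classical
  set w : ι → E := fun j => s j • y j with hw
  set A := frameOp σ w with hAdef
  set V := Submodule.span ℝ (w '' σ) with hV
  have hb0 : 0 < b := hβ.trans hβb
  have hA : A.IsSymmetric := frameOp_isSymmetric
  have hAV : ∀ x, A x ∈ V := frameOp_mem_span
  have hlow : ∀ x ∈ V, b * ‖x‖ ^ 2 ≤ ⟪A x, x⟫ := fun x hx =>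
    frameOp_lower_bound hb0.le hS.lower hx
  obtain ⟨Nu, hNu, hpotu⟩ := hS.upper_potential
  obtain ⟨Nl, hNl, hpotl⟩ := hS.lower_potential
  obtain ⟨Mu, hMu⟩ := exists_isResolvent_above one_pos hS.upper
  obtain ⟨Ml, hMl⟩ := exists_isResolvent_below hAV hlow hβ hβb
  have hfin : (Module.finrank ℝ V : ℝ) ≤ σ.card := by
    have h1 := finrank_span_finset_le_card (R := ℝ) (σ.image w)
    rw [Finset.coe_image] at h1
    change Module.finrank ℝ V ≤ _ at h1
    exact_mod_cast h1.trans Finset.card_image_le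
  obtain ⟨hDu, hup⟩ := upper_average hA hR hS.upper hNu hMu hpotu
  obtain ⟨hDl, hlo⟩ := lower_average hA hAV hlow hR hβ hβb hNl hMl
    (hdim.trans (mul_le_mul_of_nonneg_left (by linarith) (sub_pos.2 hβb).le))
    (hpotl.trans (by linarith))
  set Du := ∑ i, ⟪Mu (y i), y i⟫ - ∑ i, ⟪Nu (y i), y i⟫ with hDu_def
  set Dl := ∑ i, ⟪Nl (y i), y i⟫ - ∑ i, ⟪Ml (y i), y i⟫ with hDl_def
  obtain ⟨j, hyj, hj⟩ := exists_le_of_sum_le_of_support (P := fun j => y j ≠ 0)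
    (fun j h => by simp [not_not.1 h]) (fun j h => by simp [not_not.1 h])
    (two_pos.trans_le hlo) (hup.trans hlo)
  have sum_pos : ∀ M : E →ₗ[ℝ] E, ⟪M (y j), y j⟫ < 0 → 0 < ∑ i, ⟪y i, M (y j)⟫ ^ 2 := by
    intro M hM
    refine Finset.sum_pos' (fun i _ => sq_nonneg _) ⟨j, Finset.mem_univ j, ?_⟩
    rw [real_inner_comm]
    exact sq_pos_of_neg hM
  have hMuj : ⟪Mu (y j), y j⟫ < 0 := inner_resolvent_neg one_pos hS.upper hMu hyj
  set ru := ∑ i, ⟪y i, Mu (y j)⟫ ^ 2 with hru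
  set rl := ∑ i, ⟪y i, Ml (y j)⟫ ^ 2 with hrl
  have hru0 : 0 < ru := sum_pos Mu hMuj
  have hDu0 : 0 < Du := hru0.trans_le <| (hR _).trans <|
    (Finset.single_le_sum (f := fun j => ‖Mu (y j)‖ ^ 2) (fun i _ => sq_nonneg _)
      (Finset.mem_univ j)).trans hDu
  set U := ru / Du - ⟪Mu (y j), y j⟫ with hU
  have hU0 : 0 < U := by
    have : 0 < ru / Du := by positivity
    linarith
  have hMlj : ⟪Ml (y j), y j⟫ < 0 := by
    have : 0 ≤ rl / Dl := div_nonneg (Finset.sum_nonneg fun i _ => sq_nonneg _) hDl.le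
    linarith
  have hrl0 : 0 < rl := sum_pos Ml hMlj
  have hjσ : j ∉ σ := by
    intro hjσ
    have h1 : y j ∈ V := by
      have h2 : s j • y j ∈ V := Submodule.subset_span ⟨j, hjσ, rfl⟩
      exact (V.smul_mem_iff (hS.scalar_ne_zero j hjσ)).1 h2
    exact hMlj.not_ge (inner_resolvent_nonneg hAV hlow hβ.ne' hβb.le hMl h1)
  set t := (√U)⁻¹ with ht
  have htU : t ^ 2 * U = 1 := by
    rw [ht, inv_pow, Real.sq_sqrt hU0.le, inv_mul_cancel₀ hU0.ne']
  have ht0 : t ≠ 0 := inv_ne_zero (Real.sqrt_ne_zero'.2 hU0)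
  have inner_smul : ∀ M : E →ₗ[ℝ] E, ⟪M (t • y j), t • y j⟫ = t ^ 2 * ⟪M (y j), y j⟫ := by
    intro M
    rw [map_smul, real_inner_smul_left, real_inner_smul_right]
    ring
  have sum_smul : ∀ M : E →ₗ[ℝ] E,
      ∑ i, ⟪y i, M (t • y j)⟫ ^ 2 = t ^ 2 * ∑ i, ⟪y i, M (y j)⟫ ^ 2 := by
    intro M
    rw [Finset.mul_sum]
    refine Finset.sum_congr rfl fun i _ => ?_
    rw [map_smul, real_inner_smul_right]
    ring
  have hu1 : 1 + ⟪Mu (t • y j), t • y j⟫ = t ^ 2 * (ru / Du) := by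
    rw [inner_smul, ← htU, hU]
    ring
  have hu1pos : 0 < 1 + ⟪Mu (t • y j), t • y j⟫ := by
    rw [hu1]
    positivity
  have hl1 : 1 + ⟪Ml (t • y j), t • y j⟫ ≤ -(t ^ 2 * (rl / Dl)) := by
    have := mul_le_mul_of_nonneg_left hj (sq_nonneg t)
    rw [inner_smul]
    linarith
  have hl1pos : 0 < t ^ 2 * (rl / Dl) := by positivity
  have hl1neg : 1 + ⟪Ml (t • y j), t • y j⟫ < 0 := hl1.trans_lt (neg_neg_of_pos hl1pos)
  refine ⟨j, hjσ, t, ?_, ?_, ?_, ?_, ?_⟩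
  · intro i hi
    rcases Finset.mem_insert.1 hi with rfl | hi
    · rwa [Function.update_self]
    · rw [Function.update_of_ne (ne_of_mem_of_not_mem hi hjσ)]
      exact hS.scalar_ne_zero i hi
  · rw [frameOp_insert_update hjσ]
    refine upper_bound_rankOneUpdate hA (fun v => (hS.upper v).trans ?_) hMu _ hu1pos.le
    exact mul_le_mul_of_nonneg_right (by linarith) (sq_nonneg _)
  · rw [frameOp_insert_update hjσ]
    refine ⟨_, hMu.rankOneUpdate hA _ hu1pos.ne', ?_⟩
    rw [IsResolvent.sum_inner_rankOneUpdate, sum_smul, hu1, ← hru]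
    have : (t ^ 2 * (ru / Du))⁻¹ * (t ^ 2 * ru) = Du := by
      field_simp
    rw [this]
    linarith
  · intro a
    have h := lower_bound_insert (τ := a j) hβ hβb.le hS.lower hMl (x := t • y j)
      (by linarith) a
    rw [Finset.sum_insert hjσ, Finset.sum_insert hjσ, Function.update_self]
    convert h using 5 with i hi
    rw [Function.update_of_ne (ne_of_mem_of_not_mem hi hjσ)]
  · rw [frameOp_insert_update hjσ]
    refine ⟨_, hMl.rankOneUpdate hA _ hl1neg.ne, ?_⟩
    rw [IsResolvent.sum_inner_rankOneUpdate, sum_smul, ← hrl]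
    have : -(1 + ⟪Ml (t • y j), t • y j⟫)⁻¹ * (t ^ 2 * rl) ≤ Dl := by
      rw [← inv_neg, inv_mul_le_iff₀ (neg_pos.2 hl1neg)]
      have h1 := mul_le_mul_of_nonneg_right (le_neg_of_le_neg hl1) hDl.le
      have h2 : t ^ 2 * (rl / Dl) * Dl = t ^ 2 * rl := by
        field_simp
      linarith
    linarith

/-- Normalised restricted invertibility: from vectors `y j` with `∑ y j ⊗ y j ≤ 1` one can select
`κ < ∑ ‖y j‖²` of them which, suitably rescaled, form a Riesz sequence. -/
theorem exists_riesz_selection [FiniteDimensional ℝ E] [Fintype ι] {y : ι → E}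
    (hR : ∀ z, ∑ j, ⟪y j, z⟫ ^ 2 ≤ ‖z‖ ^ 2) {κ : ℕ} (hκ : (κ : ℝ) < ∑ j, ‖y j‖ ^ 2) :
    ∃ (σ : Finset ι) (s : ι → ℝ) (b u : ℝ), σ.card = κ ∧ (∀ j ∈ σ, s j ≠ 0) ∧ 0 < b ∧ 0 < u ∧
      √(u / b) ≤ 2 * (∑ j, ‖y j‖ ^ 2 + κ) / (∑ j, ‖y j‖ ^ 2 - κ) ∧
      ∀ a : ι → ℝ, b * ∑ j ∈ σ, a j ^ 2 ≤ ‖∑ j ∈ σ, a j • s j • y j‖ ^ 2 ∧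
        ‖∑ j ∈ σ, a j • s j • y j‖ ^ 2 ≤ u * ∑ j ∈ σ, a j ^ 2 := by
  classical
  set h := ∑ j, ‖y j‖ ^ 2 with hh
  have hκ0 : (0 : ℝ) ≤ κ := Nat.cast_nonneg κ
  have hpos : 0 < h := hκ0.trans_lt hκ
  set g := (h + κ) / 2 with hg
  have hg0 : 0 < g := by positivity
  have hgh : g < h := by linarith
  have hκg : κ < g := by linarith
  set δ := (h - g) / (2 * g) with hδ
  have hδ0 : 0 < δ := div_pos (by linarith) (by linarith)
  have hstep : ∀ k : ℕ, k ≤ κ → ∃ (σ : Finset ι) (s : ι → ℝ), σ.card = k ∧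
      IsBarrierState y σ s (h + k) (δ * (g - k)) (h / (δ * g)) := by
    intro k
    induction k with
    | zero =>
      intro _
      have resolvent_zero : ∀ β : ℝ, β ≠ 0 →
          IsResolvent (frameOp (∅ : Finset ι) fun j => (1 : ι → ℝ) j • y j) β
            (-β⁻¹ • LinearMap.id) := by
        intro β hβ x
        simp [frameOp, smul_smul, hβ]
      have sum_zero : ∀ β : ℝ, ∑ j, ⟪(-β⁻¹ • LinearMap.id : E →ₗ[ℝ] E) (y j), y j⟫ =
          -(β⁻¹ * h) := by
        intro β
        rw [hh, Finset.mul_sum, ← Finset.sum_neg_distrib]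
        refine Finset.sum_congr rfl fun j _ => ?_
        rw [LinearMap.smul_apply, LinearMap.id_apply, real_inner_smul_left,
          real_inner_self_eq_norm_sq, neg_mul]
      refine ⟨∅, 1, rfl, by simp, fun v => ?_, ⟨_, resolvent_zero _ ?_, ?_⟩, fun a => by simp,
        ⟨_, resolvent_zero _ ?_, ?_⟩⟩
      · simp only [frameOp, Finset.sum_empty, LinearMap.zero_apply, inner_zero_left]
        positivity
      · simpa using hpos.ne'
      · rw [sum_zero]
        simp [hpos.ne']
      · simpa using ⟨hδ0.ne', hg0.ne'⟩
      · rw [sum_zero, Nat.cast_zero, sub_zero, div_eq_inv_mul]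
    | succ k ih =>
      intro hk
      obtain ⟨σ, s, hσ, hS⟩ := ih (Nat.le_of_succ_le hk)
      have hkκ : (k : ℝ) + 1 ≤ κ := by exact_mod_cast hk
      have hgap : δ * (g - k) - δ * (g - (k + 1)) = δ := by ring
      obtain ⟨j, hj, t, hS'⟩ := hS.exists_insert hR (β := δ * (g - (k + 1)))
        (mul_pos hδ0 (by linarith)) (by linarith)
        (by
          rw [hgap, hδ]
          have : h - g ≠ 0 := by linarith
          field_simp
          apply le_of_eq
          ring)
        (by
          rw [hgap, hσ]
          exact mul_le_mul_of_nonneg_left (by linarith) hδ0.le)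
      refine ⟨insert j σ, Function.update s j t, by rw [Finset.card_insert_of_notMem hj, hσ], ?_⟩
      push_cast
      rwa [← add_assoc]
  obtain ⟨σ, s, hσ, hS⟩ := hstep κ le_rfl
  have hb0 : 0 < δ * (g - κ) := mul_pos hδ0 (by linarith)
  have hu0 : 0 < h + κ := by linarith
  refine ⟨σ, s, δ * (g - κ), h + κ, hσ, hS.scalar_ne_zero, hb0, hu0, ?_,
    fun a => ⟨hS.lower a, ?_⟩⟩
  · have hd : 0 < h - κ := by linarith
    refine Real.sqrt_le_iff.2 ⟨by positivity, le_of_eq ?_⟩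
    have h1 : h - g = (h - κ) / 2 := by rw [hg]; ring
    have h2 : g - κ = (h - κ) / 2 := by rw [hg]; ring
    rw [hδ, h1, h2, hg]
    field_simp
  · exact frameOp_upper_bound hu0.le hS.upper a

end Frame

/-! ### Decompositions of the identity -/

section Decomposition

variable {E : Type*} [NormedAddCommGroup E] [InnerProductSpace ℝ E] {ι : Type*} [Fintype ι]
  {x : ι → E}

theorem sum_sq_inner_of_decomposition (hx : ∀ v, ∑ j, ⟪x j, v⟫ • x j = v) (v : E) :
    ∑ j, ⟪x j, v⟫ ^ 2 = ‖v‖ ^ 2 := by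
  have h := congrArg (fun z => ⟪z, v⟫) (hx v)
  simpa only [sum_inner, real_inner_smul_left, real_inner_self_eq_norm_sq, ← sq] using h

theorem sum_norm_sq_apply_of_decomposition [FiniteDimensional ℝ E] {ι' : Type*} [Fintype ι']
    (e : OrthonormalBasis ι' ℝ E) (hx : ∀ v, ∑ j, ⟪x j, v⟫ • x j = v) (T : E →L[ℝ] E) :
    ∑ j, ‖T (x j)‖ ^ 2 = ∑ i, ‖T (e i)‖ ^ 2 := by
  have h1 : ∀ v, ‖v‖ ^ 2 = ∑ i, ⟪e i, v⟫ ^ 2 := fun v => by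
    rw [← e.sum_sq_norm_inner_right v]
    simp
  calc ∑ j, ‖T (x j)‖ ^ 2 = ∑ i, ∑ j, ⟪x j, T.adjoint (e i)⟫ ^ 2 := by
        simp_rw [fun k => h1 (T k)]
        rw [Finset.sum_comm]
        simp_rw [ContinuousLinearMap.adjoint_inner_right, real_inner_comm]
    _ = ∑ i, ∑ k, ⟪e k, T.adjoint (e i)⟫ ^ 2 := by
        simp_rw [sum_sq_inner_of_decomposition hx, h1]
    _ = ∑ k, ‖T (e k)‖ ^ 2 := by
        simp_rw [fun k => h1 (T k)]
        rw [Finset.sum_comm]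
        simp_rw [ContinuousLinearMap.adjoint_inner_right, real_inner_comm]

theorem sum_sq_inner_apply_le [FiniteDimensional ℝ E] (hx : ∀ v, ∑ j, ⟪x j, v⟫ • x j = v)
    {T : E →L[ℝ] E} (hT : ‖T‖ ≤ 1) (z : E) : ∑ j, ⟪T (x j), z⟫ ^ 2 ≤ ‖z‖ ^ 2 := by
  simp_rw [← ContinuousLinearMap.adjoint_inner_right]
  rw [sum_sq_inner_of_decomposition hx]
  refine pow_le_pow_left₀ (norm_nonneg _) ?_ 2
  refine (T.adjoint.le_opNorm z).trans ?_
  rw [LinearIsometryEquiv.norm_map]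
  exact mul_le_of_le_one_left (norm_nonneg _) hT

end Decomposition

theorem isEquivToOrthogonalBasis_of_sq_bounds {E : Type*} [NormedAddCommGroup E]
    [NormedSpace ℝ E] {m : ℕ} {K b u : ℝ} {σ : Finset (Fin m)} {y : Fin m → E} {s : Fin m → ℝ}
    (hs : ∀ j ∈ σ, s j ≠ 0) (hb : 0 < b) (hu : 0 < u) (hK : √(u / b) ≤ K)
    (h : ∀ a : Fin m → ℝ, b * ∑ j ∈ σ, a j ^ 2 ≤ ‖∑ j ∈ σ, a j • s j • y j‖ ^ 2 ∧
      ‖∑ j ∈ σ, a j • s j • y j‖ ^ 2 ≤ u * ∑ j ∈ σ, a j ^ 2) :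
    IsEquivToOrthogonalBasis K σ y := by
  refine ⟨s, (√b)⁻¹, √u, hs, inv_pos.2 (Real.sqrt_pos.2 hb), Real.sqrt_pos.2 hu, ?_, fun a => ?_⟩
  · rwa [inv_mul_eq_div, ← Real.sqrt_div hu.le]
  · simp_rw [mul_smul]
    rw [inv_inv, ← Real.sqrt_mul hb.le, ← Real.sqrt_mul hu.le]
    exact ⟨Real.sqrt_le_iff.2 ⟨norm_nonneg _, (h a).1⟩, Real.le_sqrt_of_sq_le (h a).2⟩

/-- main extraction theorem, cardinality form. There is an absolute
constant `c > 0` and a function `C : (0,1) → (0,∞)` such that for every decomposition of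
the identity `(x j)_{j ≤ m}` on `ℝⁿ`, every norm-one operator `T` with `h = ‖T‖_HS²` and
every positive integer `κ < h` there is a subset `σ` with `|σ| = κ` on which `(T x j)` is
`C(κ/h)`-equivalent to an orthogonal basis and `‖T x j‖ ≥ c √((h-κ)/n) ‖x j‖`. -/
theorem john_decomposition_selection_card :
    ∃ c : ℝ, 0 < c ∧ ∃ C : ℝ → ℝ, (∀ t, 0 < C t) ∧
      ∀ (n m : ℕ), 0 < n → 0 < m →
      ∀ x : Fin m → EuclideanSpace ℝ (Fin n),
      (∀ v : EuclideanSpace ℝ (Fin n), ∑ j, ⟪x j, v⟫ • x j = v) →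
      ∀ T : EuclideanSpace ℝ (Fin n) →L[ℝ] EuclideanSpace ℝ (Fin n), ‖T‖ = 1 →
      ∀ κ : ℕ, 0 < κ → (κ : ℝ) < hsNormSq T →
      ∃ σ : Finset (Fin m),
        σ.card = κ ∧
        IsEquivToOrthogonalBasis (C ((κ : ℝ) / hsNormSq T)) σ (fun j => T (x j)) ∧
        ∀ j ∈ σ,
          c * Real.sqrt ((hsNormSq T - κ) / n) * ‖x j‖ ≤ ‖T (x j)‖ := by
  refine ⟨1 / 2, by norm_num, fun t => 6 / |1 - t| + 1, fun t => by positivity, ?_⟩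
  intro n m hn _ x hx T hT κ hκ0 hκ
  classical
  set h := hsNormSq T with hh
  have hn' : (0 : ℝ) < n := Nat.cast_pos.2 hn
  have hκ' : (0 : ℝ) < κ := Nat.cast_pos.2 hκ0
  have hpos : 0 < h := hκ'.trans hκ
  have hTx : ∑ j, ‖T (x j)‖ ^ 2 = h := by
    rw [sum_norm_sq_apply_of_decomposition (EuclideanSpace.basisFun (Fin n) ℝ) hx]
    simp [hh, hsNormSq]
  have hxn : ∑ j, ‖x j‖ ^ 2 = n := by
    have := sum_norm_sq_apply_of_decomposition (EuclideanSpace.basisFun (Fin n) ℝ) hx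
      (ContinuousLinearMap.id ℝ _)
    simpa using this
  set r := 1 / 2 * √((h - κ) / n) with hr
  have hr2 : r ^ 2 * n = (h - κ) / 4 := by
    rw [hr, mul_pow, Real.sq_sqrt (div_nonneg (by linarith) hn'.le)]
    field_simp
    ring
  let y : Fin m → EuclideanSpace ℝ (Fin n) :=
    fun j => if r * ‖x j‖ ≤ ‖T (x j)‖ then T (x j) else 0
  have hR : ∀ z, ∑ j, ⟪y j, z⟫ ^ 2 ≤ ‖z‖ ^ 2 := fun z => by
    refine le_trans (Finset.sum_le_sum fun j _ => ?_) (sum_sq_inner_apply_le hx hT.le z)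
    by_cases hj : r * ‖x j‖ ≤ ‖T (x j)‖
    · simp [y, hj]
    · simp only [y, hj, if_false, inner_zero_left, ne_eq, OfNat.ofNat_ne_zero,
        not_false_eq_true, zero_pow]
      exact sq_nonneg _
  have hy_le : ∑ j, ‖y j‖ ^ 2 ≤ h := by
    rw [← hTx]
    refine Finset.sum_le_sum fun j _ => ?_
    by_cases hj : r * ‖x j‖ ≤ ‖T (x j)‖
    · simp [y, hj]
    · simp [y, hj]
  have hy_ge : h - (h - κ) / 4 ≤ ∑ j, ‖y j‖ ^ 2 := by
    rw [← hTx, sub_le_iff_le_add, hTx, ← hr2, ← hxn, ← hTx, Finset.mul_sum,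
      ← Finset.sum_add_distrib]
    refine Finset.sum_le_sum fun j _ => ?_
    by_cases hj : r * ‖x j‖ ≤ ‖T (x j)‖
    · simp only [y, hj, if_true]
      linarith [mul_nonneg (sq_nonneg r) (sq_nonneg ‖x j‖)]
    · simp only [y, hj, if_false, norm_zero]
      have := pow_le_pow_left₀ (norm_nonneg _) (not_le.1 hj).le 2
      linarith [mul_pow r ‖x j‖ 2]
  obtain ⟨σ, s, b, u, hσ, hs, hb, hu, hK, hbd⟩ :=
    exists_riesz_selection hR (κ := κ) (by linarith)
  have hmem : ∀ j ∈ σ, r * ‖x j‖ ≤ ‖T (x j)‖ := by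
    intro j hj
    by_contra hlt
    have h0 : y j = 0 := if_neg hlt
    have h1 := (hbd (Pi.single j 1)).1
    rw [Finset.sum_eq_single_of_mem j hj (fun i _ hi => by simp [hi]),
      Finset.sum_eq_single_of_mem j hj (fun i _ hi => by simp [hi]), h0] at h1
    simp only [Pi.single_eq_same, smul_zero, norm_zero] at h1
    linarith
  have hyT : ∀ j ∈ σ, y j = T (x j) := fun j hj => if_pos (hmem j hj)
  have hsum : ∀ a : Fin m → ℝ,
      ∑ j ∈ σ, a j • s j • y j = ∑ j ∈ σ, a j • s j • T (x j) := fun a =>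
    Finset.sum_congr rfl fun j hj => by rw [hyT j hj]
  simp_rw [hsum] at hbd
  refine ⟨σ, hσ, isEquivToOrthogonalBasis_of_sq_bounds hs hb hu (hK.trans ?_) hbd, hmem⟩
  have hd : 0 < h - κ := sub_pos.2 hκ
  have h1 : |1 - κ / h| = (h - κ) / h := by
    rw [abs_of_pos (sub_pos.2 ((div_lt_one hpos).2 hκ))]
    field_simp
  beta_reduce
  rw [h1]
  calc 2 * (∑ j, ‖y j‖ ^ 2 + κ) / (∑ j, ‖y j‖ ^ 2 - κ)
      ≤ 4 * h / (3 / 4 * (h - κ)) := by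
        apply div_le_div₀ <;> linarith
    _ ≤ 6 / ((h - κ) / h) := by
        rw [div_div_eq_mul_div, div_le_div_iff₀ (by linarith) hd]
        nlinarith [mul_pos hpos hd]
    _ ≤ 6 / ((h - κ) / h) + 1 := by linarith
end

section
/- For every ε ∈ (0,1) there is a constant C(ε) > 0 depending only on ε with the following property. Let T be a Hilbert–Schmidt linear operator on l₂ (the separable infinite-dimensional Hilbert space with canonical basis (e_j)_{j≥1}) with operator norm ‖T‖ = 1. Then there exists a subset σ ⊆ {1, 2, …} of cardinality |σ| ≥ (1−ε)‖T‖_HS² such that the sequence (T e_j)_{j∈σ} is C(ε)-equivalent to an orthogonal basis in Hilbert space. -/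
section Resolvent

variable {E : Type*} [NormedAddCommGroup E] [InnerProductSpace ℝ E]

/-- `R` is the resolvent `(A - c)⁻¹` of the linear operator `A` at the point `c`. -/
structure IsResolventAt (A : E →ₗ[ℝ] E) (c : ℝ) (R : E →ₗ[ℝ] E) : Prop where
  left : ∀ x, R (A x - c • x) = x
  right : ∀ x, A (R x) - c • R x = x

theorem exists_isResolventAt [FiniteDimensional ℝ E] {A : E →ₗ[ℝ] E} {c : ℝ}
    (h : ∀ z, A z = c • z → z = 0) : ∃ R, IsResolventAt A c R := by
  have hinj : Function.Injective (A - c • (1 : E →ₗ[ℝ] E)) := by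
    rw [injective_iff_map_eq_zero]
    intro z hz
    exact h z (sub_eq_zero.mp (by simpa using hz))
  let e := LinearEquiv.ofInjectiveEndo _ hinj
  have he : ∀ x, e x = A x - c • x := fun x => by
    simp [e, LinearEquiv.coe_ofInjectiveEndo]
  refine ⟨e.symm.toLinearMap, fun x => ?_, fun x => ?_⟩
  · rw [← he]; simp
  · simpa using (he (e.symm x)).symm

theorem inner_sub_smul_rankOne (R : E →ₗ[ℝ] E) (w x : E) :
    inner ℝ x ((R - (1 + inner ℝ w (R w))⁻¹ • (innerₛₗ ℝ (R w)).smulRight (R w)) x) =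
      inner ℝ x (R x) - inner ℝ x (R w) ^ 2 / (1 + inner ℝ w (R w)) := by
  simp only [LinearMap.sub_apply, LinearMap.smul_apply,
      LinearMap.smulRight_apply, innerₛₗ_apply_apply, inner_sub_right, inner_smul_right]
  rw [real_inner_comm x (R w)]
  ring

namespace IsResolventAt

variable {A R R' : E →ₗ[ℝ] E} {c c' : ℝ}

theorem isSymmetric (hA : A.IsSymmetric) (hR : IsResolventAt A c R) : R.IsSymmetric := by
  intro x y
  have hx := hR.right x
  have hy := hR.right y
  have h := hA (R x) (R y)
  calc inner ℝ (R x) y = inner ℝ (R x) (A (R y) - c • R y) := by rw [hy]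
    _ = inner ℝ (A (R x) - c • R x) (R y) := by
      simp only [inner_sub_left, inner_sub_right, inner_smul_left, inner_smul_right]
      simp [h]
    _ = inner ℝ x (R y) := by rw [hx]

/-- The resolvent identity. -/
theorem sub_apply (hR : IsResolventAt A c R) (hR' : IsResolventAt A c' R') (x : E) :
    R x - R' x = (c - c') • R (R' x) := by
  have h1 := hR'.right x
  have h2 : R x = R (A (R' x) - c • R' x + (c - c') • R' x) := by
    congr 1
    rw [← h1, h1, sub_smul]
    nth_rewrite 1 [← h1]
    abel
  rw [map_add, hR.left, map_smul] at h2
  rw [h2]; abel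

theorem inner_sub_inner (hR : IsResolventAt A c R) (hR' : IsResolventAt A c' R') (x : E) :
    inner ℝ x (R x) - inner ℝ x (R' x) = (c - c') * inner ℝ x (R (R' x)) := by
  rw [← inner_sub_right, hR.sub_apply hR', inner_smul_right]

/-- The Sherman–Morrison formula for the resolvent of a symmetric operator. -/
theorem add_rankOne (hA : A.IsSymmetric) (hR : IsResolventAt A c R) {w : E}
    (hw : 1 + inner ℝ w (R w) ≠ 0) :
    IsResolventAt (A + (innerₛₗ ℝ w).smulRight w) c
      (R - (1 + inner ℝ w (R w))⁻¹ • (innerₛₗ ℝ (R w)).smulRight (R w)) := by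
  have hs := hR.isSymmetric hA
  set α : ℝ := inner ℝ w (R w) with hα
  refine ⟨fun x => ?_, fun x => ?_⟩
  · have h1 : inner ℝ (R w) (A x - c • x) = inner ℝ w x := by rw [hs, hR.left]
    have h2 : inner ℝ (R w) w = α := by rw [hs]
    have h3 : (A x + inner ℝ w x • w - c • x) = (A x - c • x) + inner ℝ w x • w := by abel
    simp only [LinearMap.add_apply, LinearMap.sub_apply, LinearMap.smul_apply,
      LinearMap.smulRight_apply, innerₛₗ_apply_apply]
    rw [h3, map_add, hR.left, map_smul, inner_add_right, h1, inner_smul_right, h2, smul_smul,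
      add_sub_assoc, ← sub_smul]
    have : inner ℝ w x - (1 + α)⁻¹ * (inner ℝ w x + inner ℝ w x * α) = 0 := by
      field_simp; ring
    rw [this]; simp
  · have h1 : inner ℝ (R w) x = inner ℝ w (R x) := hs _ _
    simp only [LinearMap.add_apply, LinearMap.sub_apply, LinearMap.smul_apply,
      LinearMap.smulRight_apply, innerₛₗ_apply_apply, map_sub, map_smul, h1]
    rw [← hα]
    set β : ℝ := inner ℝ w (R x)
    have h2 : A (R x) = x + c • R x := by rw [← sub_eq_iff_eq_add]; exact hR.right x
    have h3 : A (R w) = w + c • R w := by rw [← sub_eq_iff_eq_add]; exact hR.right w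
    rw [h2, h3]
    have hβ : β • w = ((1 + α)⁻¹ * β * (1 + α)) • w := by
      congr 1; field_simp
    rw [hβ]
    module

/-! ### Resolvents inside the spectral gap `(0, b)` of a positive operator -/

section Gap

variable {b b' : ℝ}

theorem exists_of_gap [FiniteDimensional ℝ E]
    (hgap : ∀ z, b * inner ℝ (A z) z ≤ inner ℝ (A z) (A z)) (hb' : 0 < b') (hb : b' < b) :
    ∃ R, IsResolventAt A b' R := by
  refine exists_isResolventAt fun z hz => ?_
  have h := hgap z
  rw [hz] at h
  simp only [inner_smul_left, inner_smul_right, conj_trivial] at h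
  have h0 : inner ℝ z z * (b' * (b - b')) ≤ 0 := by linarith
  have hp : 0 < b' * (b - b') := mul_pos hb' (sub_pos.2 hb)
  have : inner ℝ z z ≤ 0 := by
    by_contra! hc
    exact absurd h0 (not_le.2 (mul_pos hc hp))
  exact inner_self_eq_zero.1 (le_antisymm this real_inner_self_nonneg)

theorem neg_norm_sq_le (hgap : ∀ z, b' * inner ℝ (A z) z ≤ inner ℝ (A z) (A z))
    (hR : IsResolventAt A b' R) (x : E) :
    -‖x‖ ^ 2 ≤ b' * inner ℝ x (R x) := by
  have h := hgap (R x)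
  have h2 : A (R x) = x + b' • R x := by rw [← sub_eq_iff_eq_add]; exact hR.right x
  rw [h2] at h
  simp only [inner_add_left, inner_add_right, inner_smul_left, inner_smul_right,
    conj_trivial] at h
  rw [real_inner_self_eq_norm_sq x, real_inner_comm x (R x)] at h
  linarith

theorem mul_norm_sq_le_of_gap (hA : A.IsSymmetric)
    (hgap : ∀ z, b * inner ℝ (A z) z ≤ inner ℝ (A z) (A z)) (hb : b' ≤ b)
    (hR : IsResolventAt A b R) (hR' : IsResolventAt A b' R') (x : E) :
    b' * ‖R' x‖ ^ 2 ≤ b * inner ℝ x (R (R' x)) := by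
  obtain ⟨z, hz⟩ : ∃ z, z = R (R' x) := ⟨_, rfl⟩
  have hy : R' x = A z - b • z := by rw [hz]; exact (hR.right _).symm
  have hx : x = A (R' x) - b' • R' x := (hR'.right _).symm
  rw [← hz, ← real_inner_self_eq_norm_sq]
  have e1 : inner ℝ x z = inner ℝ (R' x) (A z) - b' * inner ℝ (R' x) z := by
    nth_rewrite 1 [hx]
    rw [inner_sub_left, hA, inner_smul_left]; simp
  rw [e1, hy]
  simp only [inner_sub_left, inner_sub_right, inner_smul_left, inner_smul_right, conj_trivial]
  have h := hgap z
  rw [real_inner_comm] at h ⊢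
  nlinarith [mul_le_mul_of_nonneg_left h (sub_nonneg.2 hb)]

theorem neg_inner_le_of_gap (hA : A.IsSymmetric) (hpos : ∀ z, 0 ≤ inner ℝ (A z) z)
    (hgap : ∀ z, b * inner ℝ (A z) z ≤ inner ℝ (A z) (A z)) (hb : b' ≤ b)
    (hR : IsResolventAt A b R) (hR' : IsResolventAt A b' R') (x : E) :
    -inner ℝ x (R x) ≤ b' * inner ℝ x (R (R' x)) := by
  have hs := hR.sub_apply hR' x
  obtain ⟨z, hz⟩ : ∃ z, z = R (R' x) := ⟨_, rfl⟩
  have hy : R' x = A z - b • z := by rw [hz]; exact (hR.right _).symm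
  have hx : x = A (R' x) - b' • R' x := (hR'.right _).symm
  rw [← hz] at hs ⊢
  have hRx : R x = A z - b' • z := by
    rw [sub_eq_iff_eq_add.1 hs, hy]; module
  have key : 0 ≤ inner ℝ x (A z) := by
    have h1 := hpos (A z - b • z)
    have h2 := hgap z
    rw [hx, hy]
    have hc := real_inner_comm z (A z)
    have hc2 := hA (A z) z
    simp only [map_sub, map_smul, inner_sub_left, inner_sub_right, inner_smul_left,
      inner_smul_right, conj_trivial] at h1 ⊢
    rw [hc2] at h1
    rw [← hc]
    nlinarith [mul_le_mul_of_nonneg_left h2 (sub_nonneg.2 hb)]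
  rw [hRx, inner_sub_right, inner_smul_right]
  linarith

end Gap

/-! ### Resolvents above the spectrum -/

section Above

variable {v v' : ℝ}

theorem exists_of_lt [FiniteDimensional ℝ E] (hle : ∀ z, inner ℝ (A z) z ≤ v * ‖z‖ ^ 2)
    (hv : v < v') : ∃ N, IsResolventAt A v' N := by
  refine exists_isResolventAt fun z hz => ?_
  have h := hle z
  rw [hz, inner_smul_left, real_inner_self_eq_norm_sq] at h
  simp only [conj_trivial] at h
  have : ‖z‖ ^ 2 ≤ 0 := by
    by_contra! hc
    nlinarith
  simpa using le_antisymm this (sq_nonneg _)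

theorem inner_nonpos (hle : ∀ z, inner ℝ (A z) z ≤ v * ‖z‖ ^ 2) (hR : IsResolventAt A v R)
    (x : E) : inner ℝ x (R x) ≤ 0 := by
  have hx := hR.right x
  have h := hle (R x)
  nth_rewrite 1 [← hx]
  rw [inner_sub_left, inner_smul_left, real_inner_self_eq_norm_sq]
  simp only [conj_trivial]
  linarith

theorem norm_sq_le_of_lt (hA : A.IsSymmetric) (hle : ∀ z, inner ℝ (A z) z ≤ v * ‖z‖ ^ 2)
    (hv : v ≤ v') (hR : IsResolventAt A v R) (hR' : IsResolventAt A v' R') (x : E) :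
    ‖R' x‖ ^ 2 ≤ inner ℝ x (R (R' x)) := by
  obtain ⟨y, hy⟩ : ∃ y, y = R' x := ⟨_, rfl⟩
  have hx : x = A y - v' • y := by rw [hy]; exact (hR'.right _).symm
  have hz : A (R y) = y + v • R y := by rw [← sub_eq_iff_eq_add]; exact hR.right y
  rw [← hy]
  have e1 : inner ℝ x (R y) = inner ℝ y (A (R y)) - v' * inner ℝ y (R y) := by
    rw [hx, inner_sub_left, hA, inner_smul_left]; simp
  rw [e1, hz, inner_add_right, inner_smul_right, real_inner_self_eq_norm_sq]
  have := hR.inner_nonpos hle y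
  nlinarith

end Above

end IsResolventAt

end Resolvent

section FrameOperator

variable {E : Type*} [NormedAddCommGroup E] [InnerProductSpace ℝ E] {ι : Type*}

/-- The frame operator `x ↦ ∑ j ∈ σ, ⟪w j, x⟫ w j` of a finite family of vectors. -/
noncomputable def frameOperator (w : ι → E) (σ : Finset ι) : E →ₗ[ℝ] E :=
  ∑ j ∈ σ, (innerₛₗ ℝ (w j)).smulRight (w j)

variable {w : ι → E} {σ : Finset ι} {b v : ℝ}

theorem frameOperator_apply (x : E) :
    frameOperator w σ x = ∑ j ∈ σ, inner ℝ (w j) x • w j := by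
  simp [frameOperator]

theorem frameOperator_insert [DecidableEq ι] {i : ι} (hi : i ∉ σ) :
    frameOperator w (insert i σ) = frameOperator w σ + (innerₛₗ ℝ (w i)).smulRight (w i) := by
  rw [frameOperator, Finset.sum_insert hi, add_comm]; rfl

theorem inner_frameOperator (x y : E) :
    inner ℝ (frameOperator w σ x) y = ∑ j ∈ σ, inner ℝ (w j) x * inner ℝ (w j) y := by
  simp [frameOperator_apply, sum_inner, inner_smul_left]

theorem inner_frameOperator_self (x : E) :
    inner ℝ (frameOperator w σ x) x = ∑ j ∈ σ, inner ℝ (w j) x ^ 2 := by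
  simp [inner_frameOperator, sq]

theorem isSymmetric_frameOperator : (frameOperator w σ).IsSymmetric := fun x y => by
  rw [inner_frameOperator, real_inner_comm, inner_frameOperator]
  exact Finset.sum_congr rfl fun _ _ => mul_comm _ _

theorem frameOperator_gap
    (hb : ∀ c : ι → ℝ, b * ∑ j ∈ σ, c j ^ 2 ≤ ‖∑ j ∈ σ, c j • w j‖ ^ 2) (z : E) :
    b * inner ℝ (frameOperator w σ z) z ≤
      inner ℝ (frameOperator w σ z) (frameOperator w σ z) := by
  rw [inner_frameOperator_self, real_inner_self_eq_norm_sq, frameOperator_apply]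
  exact hb _

theorem norm_sum_smul_sq_le (hv : 0 ≤ v)
    (h : ∀ x, inner ℝ (frameOperator w σ x) x ≤ v * ‖x‖ ^ 2) (c : ι → ℝ) :
    ‖∑ j ∈ σ, c j • w j‖ ^ 2 ≤ v * ∑ j ∈ σ, c j ^ 2 := by
  set y := ∑ j ∈ σ, c j • w j with hy
  have h1 : ‖y‖ ^ 2 = ∑ j ∈ σ, c j * inner ℝ (w j) y := by
    rw [← real_inner_self_eq_norm_sq]
    nth_rewrite 1 [hy]
    simp [sum_inner, inner_smul_left]
  have h2 := Finset.sum_mul_sq_le_sq_mul_sq σ c (fun j => inner ℝ (w j) y)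
  have h3 := h y
  rw [inner_frameOperator_self] at h3
  rw [← h1] at h2
  have h4 : 0 ≤ ∑ j ∈ σ, c j ^ 2 := Finset.sum_nonneg fun _ _ => sq_nonneg _
  rcases (sq_nonneg ‖y‖).eq_or_lt with h0 | h0
  · rw [← h0]; positivity
  · have h5 := mul_le_mul_of_nonneg_left h3 h4
    by_contra! hc
    nlinarith [mul_lt_mul_of_pos_right hc h0]

/-- Schur complement estimate: adding `w` to a family whose Gram matrix is at least `b`. -/
theorem gram_add_ge (hb : ∀ c : ι → ℝ, b * ∑ j ∈ σ, c j ^ 2 ≤ ‖∑ j ∈ σ, c j • w j‖ ^ 2)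
    {R : E →ₗ[ℝ] E} (hR : IsResolventAt (frameOperator w σ) b R) (x : E) (c : ι → ℝ) (t : ℝ) :
    b * (-1 - inner ℝ x (R x)) * t ^ 2 ≤
      ‖∑ j ∈ σ, c j • w j + t • x‖ ^ 2 - b * (∑ j ∈ σ, c j ^ 2 + t ^ 2) := by
  obtain ⟨r, hr⟩ : ∃ r, r = R x := ⟨_, rfl⟩
  have hx := hR.right x
  rw [← hr] at hx ⊢
  have h1 := hb fun j => c j + t * inner ℝ (w j) r
  have e1 : ∑ j ∈ σ, (c j + t * inner ℝ (w j) r) • w j =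
      (∑ j ∈ σ, c j • w j + t • x) + (t * b) • r := by
    rw [← hx, frameOperator_apply]
    simp only [add_smul, Finset.sum_add_distrib, mul_smul, ← Finset.smul_sum]
    module
  set y := ∑ j ∈ σ, c j • w j with hy
  have e2 : ∑ j ∈ σ, (c j + t * inner ℝ (w j) r) ^ 2 =
      ∑ j ∈ σ, c j ^ 2 + 2 * t * inner ℝ y r + t ^ 2 * (inner ℝ x r + b * ‖r‖ ^ 2) := by
    have e3 : inner ℝ x r + b * ‖r‖ ^ 2 = ∑ j ∈ σ, inner ℝ (w j) r ^ 2 := by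
      rw [← inner_frameOperator_self, ← hx, inner_sub_left, inner_smul_left,
        real_inner_self_eq_norm_sq]
      simp
    rw [e3, hy, sum_inner, Finset.mul_sum, Finset.mul_sum, ← Finset.sum_add_distrib,
      ← Finset.sum_add_distrib]
    refine Finset.sum_congr rfl fun j _ => ?_
    rw [inner_smul_left]
    simp only [conj_trivial]
    ring
  rw [e1, e2, norm_add_sq_real, norm_smul, inner_smul_right, inner_add_left, inner_smul_left,
    mul_pow, Real.norm_eq_abs, sq_abs] at h1
  simp only [conj_trivial] at h1
  linarith

theorem gram_insert_ge [DecidableEq ι] (hb0 : 0 < b)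
    (hb : ∀ c : ι → ℝ, b * ∑ j ∈ σ, c j ^ 2 ≤ ‖∑ j ∈ σ, c j • w j‖ ^ 2)
    {R : E →ₗ[ℝ] E} (hR : IsResolventAt (frameOperator w σ) b R) {i : ι}
    (hi : inner ℝ (w i) (R (w i)) < -1) :
    i ∉ σ ∧ ∀ c : ι → ℝ,
      b * ∑ j ∈ insert i σ, c j ^ 2 ≤ ‖∑ j ∈ insert i σ, c j • w j‖ ^ 2 := by
  have hpos : 0 < b * (-1 - inner ℝ (w i) (R (w i))) := mul_pos hb0 (by linarith)
  have hmem : i ∉ σ := by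
    intro hmem
    have h := gram_add_ge hb hR (w i) (fun j => if j = i then -1 else 0) 1
    simp [hmem] at h
    linarith
  refine ⟨hmem, fun c => ?_⟩
  have h := gram_add_ge hb hR (w i) c (c i)
  rw [Finset.sum_insert hmem, Finset.sum_insert hmem, add_comm (c i ^ 2), add_comm (c i • w i)]
  have := mul_nonneg hpos.le (sq_nonneg (c i))
  linarith

theorem frameOperator_insert_le [DecidableEq ι]
    (hv : ∀ x, inner ℝ (frameOperator w σ x) x ≤ v * ‖x‖ ^ 2)
    {N : E →ₗ[ℝ] E} (hN : IsResolventAt (frameOperator w σ) v N) {i : ι} (hmem : i ∉ σ)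
    (hi : -1 ≤ inner ℝ (w i) (N (w i))) (x : E) :
    inner ℝ (frameOperator w (insert i σ) x) x ≤ v * ‖x‖ ^ 2 := by
  obtain ⟨q, hq⟩ : ∃ q, q = N (w i) := ⟨_, rfl⟩
  have hw := hN.right (w i)
  have hA := isSymmetric_frameOperator (w := w) (σ := σ)
  rw [← hq] at hw hi
  set A := frameOperator w σ
  set t : ℝ := inner ℝ (w i) x with ht
  have h := hv (x + t • q)
  have e1 : inner ℝ (A q) x = t + v * inner ℝ q x := by
    rw [ht, ← hw, inner_sub_left, inner_smul_left]; simp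
  have e1' : inner ℝ (A x) q = t + v * inner ℝ q x := by
    rw [hA, real_inner_comm, e1]
  have e2 : inner ℝ (A q) q = inner ℝ (w i) q + v * ‖q‖ ^ 2 := by
    rw [← real_inner_self_eq_norm_sq]
    rw [← hw, inner_sub_left, inner_smul_left]; simp
  rw [frameOperator_insert hmem, LinearMap.add_apply, inner_add_left]
  simp only [LinearMap.smulRight_apply, innerₛₗ_apply_apply, inner_smul_left, conj_trivial]
  rw [map_add, map_smul, norm_add_sq_real, norm_smul, Real.norm_eq_abs, mul_pow, sq_abs] at h
  simp only [inner_add_left, inner_add_right, inner_smul_left, inner_smul_right, conj_trivial]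
    at h
  rw [e1, e1', e2, real_inner_comm q x] at h
  have := mul_le_mul_of_nonneg_left hi (sq_nonneg t)
  change inner ℝ (A x) x + t * t ≤ _
  nlinarith

end FrameOperator

section Barrier

variable {E : Type*} [NormedAddCommGroup E] [InnerProductSpace ℝ E] {ι : Type*}

/-- One step of the two-barrier argument: averaging over the family `u` produces a direction
along which both the lower barrier (moved from `b` to `b'`) and the upper barrier (moved from
`v` to `v'`) can be maintained. -/
theorem exists_direction {s : Finset ι} {u : ι → E} {A R R' N N' : E →ₗ[ℝ] E}
    {b b' v v' b₀ v₀ h : ℝ} (hA : A.IsSymmetric) (hpos : ∀ z, 0 ≤ inner ℝ (A z) z)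
    (hgap : ∀ z, b * inner ℝ (A z) z ≤ inner ℝ (A z) (A z))
    (hle : ∀ z, inner ℝ (A z) z ≤ v * ‖z‖ ^ 2)
    (hM : ∀ x, ∑ j ∈ s, inner ℝ (u j) x ^ 2 ≤ ‖x‖ ^ 2)
    (hh : ∑ j ∈ s, ‖u j‖ ^ 2 = h) (h0 : 0 < h)
    (hR : IsResolventAt A b R) (hR' : IsResolventAt A b' R')
    (hN : IsResolventAt A v N) (hN' : IsResolventAt A v' N')
    (hb' : 0 < b') (hb : b' < b) (hv : v < v') (hb₀ : 0 < b₀) (hstep : b₀ ≤ (b - b') * h)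
    (hΦ : ∑ j ∈ s, inner ℝ (u j) (R (u j)) ≤ -(h / b₀))
    (hΨ : -(h / v₀) ≤ ∑ j ∈ s, inner ℝ (u j) (N (u j)))
    (hsur : (h / v₀ + 1 / (v' - v)) / b' < h / b₀ - h - 1 / (b - b')) :
    ∃ i ∈ s, ∃ w, w = ‖u i‖⁻¹ • u i ∧
      inner ℝ w (R' w) < -1 ∧ -1 < inner ℝ w (N' w) ∧
      ∑ j ∈ s, inner ℝ (u j) (R' w) ^ 2 ≤
        (∑ j ∈ s, inner ℝ (u j) (R (u j)) - ∑ j ∈ s, inner ℝ (u j) (R' (u j))) *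
          (-1 - inner ℝ w (R' w)) ∧
      ∑ j ∈ s, inner ℝ (u j) (N' w) ^ 2 ≤
        (∑ j ∈ s, inner ℝ (u j) (N' (u j)) - ∑ j ∈ s, inner ℝ (u j) (N (u j))) *
          (1 + inner ℝ w (N' w)) := by
  set Δ := ∑ j ∈ s, inner ℝ (u j) (R (u j)) - ∑ j ∈ s, inner ℝ (u j) (R' (u j)) with hΔ
  set Γ := ∑ j ∈ s, inner ℝ (u j) (N' (u j)) - ∑ j ∈ s, inner ℝ (u j) (N (u j)) with hΓ
  have hδ : 0 < b - b' := sub_pos.2 hb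
  have hη : 0 < v' - v := sub_pos.2 hv
  have hgap' : ∀ z, b' * inner ℝ (A z) z ≤ inner ℝ (A z) (A z) := fun z =>
    (mul_le_mul_of_nonneg_right hb.le (hpos z)).trans (hgap z)
  have hle' : ∀ z, inner ℝ (A z) z ≤ v' * ‖z‖ ^ 2 := fun z =>
    (hle z).trans (mul_le_mul_of_nonneg_right hv.le (sq_nonneg _))
  -- the lower barrier
  set D := ∑ j ∈ s, inner ℝ (u j) (R (R' (u j))) with hD
  set X := ∑ j ∈ s, ‖R' (u j)‖ ^ 2 with hX
  have hΔD : Δ = (b - b') * D := by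
    rw [hΔ, ← Finset.sum_sub_distrib, hD, Finset.mul_sum]
    exact Finset.sum_congr rfl fun j _ => hR.inner_sub_inner hR' _
  have hXD : b' * X ≤ b * D := by
    rw [hX, hD, Finset.mul_sum, Finset.mul_sum]
    exact Finset.sum_le_sum fun j _ => IsResolventAt.mul_norm_sq_le_of_gap hA hgap hb.le hR hR' _
  have hDlow : h / b₀ ≤ b' * D := by
    refine (le_neg_of_le_neg hΦ).trans ?_
    rw [hD, Finset.mul_sum, ← Finset.sum_neg_distrib]
    exact Finset.sum_le_sum fun j _ => IsResolventAt.neg_inner_le_of_gap hA hpos hgap hb.le hR hR' _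
  have hDpos : 0 < D := by
    have : 0 < b' * D := (div_pos h0 hb₀).trans_le hDlow
    exact pos_of_mul_pos_right this hb'.le
  have hΔpos : 0 < Δ := hΔD ▸ mul_pos hδ hDpos
  have hΔlow : 1 / b' ≤ Δ := by
    rw [div_le_iff₀ hb', hΔD]
    calc (1 : ℝ) ≤ (b - b') * (h / b₀) := by
          rw [← mul_div_assoc, le_div_iff₀ hb₀]; linarith
      _ ≤ (b - b') * (b' * D) := by gcongr
      _ = _ := by ring
  have hXΔ : X / Δ ≤ 1 / (b - b') + 1 / b' := by
    rw [div_le_iff₀ hΔpos, hΔD]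
    have : (1 / (b - b') + 1 / b') * ((b - b') * D) = b * D / b' := by
      field_simp; ring
    rw [this, le_div_iff₀ hb']
    linarith
  -- the upper barrier
  set Y := ∑ j ∈ s, ‖N' (u j)‖ ^ 2 with hY
  have hYΓ : (v' - v) * Y ≤ Γ := by
    rw [hΓ, hY, ← Finset.sum_sub_distrib, Finset.mul_sum]
    refine Finset.sum_le_sum fun j _ => ?_
    have h1 := hN.inner_sub_inner hN' (u j)
    have h2 := IsResolventAt.norm_sq_le_of_lt hA hle hv.le hN hN' (u j)
    nlinarith
  have hYpos : 0 < Y := by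
    obtain ⟨j, hj, hju⟩ : ∃ j ∈ s, 0 < ‖u j‖ ^ 2 := by
      by_contra! hc
      exact absurd (Finset.sum_nonpos hc) (by rw [hh]; exact not_le.2 h0)
    refine Finset.sum_pos' (fun _ _ => sq_nonneg _) ⟨j, hj, ?_⟩
    refine (sq_nonneg _).lt_of_ne' fun hz => ?_
    have hz' : N' (u j) = 0 := by simpa using hz
    have := hN'.right (u j)
    rw [hz'] at this
    rw [← this] at hju
    simp at hju
  have hΓpos : 0 < Γ := (mul_pos hη hYpos).trans_le hYΓ
  have hYdiv : Y / Γ ≤ 1 / (v' - v) := by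
    rw [div_le_div_iff₀ hΓpos hη]; linarith
  -- averaging
  set S : ι → ℝ := fun i => ∑ j ∈ s, inner ℝ (u j) (R' (u i)) ^ 2 with hS
  set S' : ι → ℝ := fun i => ∑ j ∈ s, inner ℝ (u j) (N' (u i)) ^ 2 with hS'
  have hSX : ∑ i ∈ s, S i ≤ X := Finset.sum_le_sum fun i _ => hM _
  have hSY : ∑ i ∈ s, S' i ≤ Y := Finset.sum_le_sum fun i _ => hM _
  have hS0 : ∀ i, 0 ≤ S i := fun i => Finset.sum_nonneg fun _ _ => sq_nonneg _
  have hS'0 : ∀ i, 0 ≤ S' i := fun i => Finset.sum_nonneg fun _ _ => sq_nonneg _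
  obtain ⟨i, his, hi⟩ : ∃ i ∈ s,
      (-inner ℝ (u i) (N' (u i)) + S' i / Γ) / b' <
        -‖u i‖ ^ 2 - inner ℝ (u i) (R' (u i)) - S i / Δ := by
    refine Finset.exists_lt_of_sum_lt ?_
    rw [← Finset.sum_div, Finset.sum_add_distrib, Finset.sum_sub_distrib, Finset.sum_sub_distrib,
      ← Finset.sum_div, ← Finset.sum_div, Finset.sum_neg_distrib, Finset.sum_neg_distrib, hh]
    have h1 : (∑ i ∈ s, S i) / Δ ≤ X / Δ := by gcongr
    have h2 : (∑ i ∈ s, S' i) / Γ ≤ Y / Γ := by gcongr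
    refine lt_of_le_of_lt ?_ (hsur.trans_le ?_)
    · gcongr ?_ / b'
      linarith
    · linarith
  have hN0 := hN'.inner_nonpos hle' (u i)
  have hRlow := hR'.neg_norm_sq_le hgap' (u i)
  have hSi : 0 ≤ S i / Δ := div_nonneg (hS0 i) hΔpos.le
  have hS'i : 0 ≤ S' i / Γ := div_nonneg (hS'0 i) hΓpos.le
  have hU : 0 ≤ (-inner ℝ (u i) (N' (u i)) + S' i / Γ) / b' :=
    div_nonneg (by linarith) hb'.le
  have hL : 0 < -‖u i‖ ^ 2 - inner ℝ (u i) (R' (u i)) - S i / Δ := hU.trans_lt hi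
  have hU1 : -inner ℝ (u i) (N' (u i)) + S' i / Γ < ‖u i‖ ^ 2 := by
    rw [div_lt_iff₀ hb'] at hi
    have : (-‖u i‖ ^ 2 - inner ℝ (u i) (R' (u i)) - S i / Δ) * b' ≤
        -(b' * inner ℝ (u i) (R' (u i))) := by
      have := mul_nonneg hSi hb'.le
      have := mul_nonneg (sq_nonneg ‖u i‖) hb'.le
      linarith
    linarith
  have hnpos : 0 < ‖u i‖ ^ 2 := by linarith
  have hn0 : ‖u i‖ ≠ 0 := fun h => by simp [h] at hnpos
  have hquad : ∀ B : E →ₗ[ℝ] E, inner ℝ (‖u i‖⁻¹ • u i) (B (‖u i‖⁻¹ • u i)) =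
      inner ℝ (u i) (B (u i)) / ‖u i‖ ^ 2 := fun B => by
    simp only [map_smul, inner_smul_left, inner_smul_right, conj_trivial]
    field_simp
  have hsum : ∀ B : E →ₗ[ℝ] E, ∑ j ∈ s, inner ℝ (u j) (B (‖u i‖⁻¹ • u i)) ^ 2 =
      (∑ j ∈ s, inner ℝ (u j) (B (u i)) ^ 2) / ‖u i‖ ^ 2 := fun B => by
    rw [Finset.sum_div]
    refine Finset.sum_congr rfl fun j _ => ?_
    simp only [map_smul, inner_smul_right]
    field_simp
  refine ⟨i, his, _, rfl, ?_, ?_, ?_, ?_⟩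
  · rw [hquad, div_lt_iff₀ hnpos]; linarith
  · rw [hquad, lt_div_iff₀ hnpos]; linarith
  · rw [hquad, hsum, div_le_iff₀ hnpos]
    have h1 : S i ≤ Δ * (-‖u i‖ ^ 2 - inner ℝ (u i) (R' (u i))) := by
      rw [mul_comm, ← div_le_iff₀ hΔpos]; linarith
    refine h1.trans_eq ?_
    field_simp
  · rw [hquad, hsum, div_le_iff₀ hnpos]
    have h1 : S' i ≤ Γ * (‖u i‖ ^ 2 + inner ℝ (u i) (N' (u i))) := by
      rw [mul_comm, ← div_le_iff₀ hΓpos]; linarith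
    refine h1.trans_eq ?_
    field_simp

end Barrier

section Selection

variable {E : Type*} [NormedAddCommGroup E] [InnerProductSpace ℝ E] {ι : Type*}

/-- The invariant of the selection process: the normalized vectors with indices in `σ` have Gram
matrix at least `b` and frame operator at most `v`, and the potentials at the barriers `b` and `v`
are controlled by `-p` and `-q`. -/
structure BarrierState (s : Finset ι) (u : ι → E) (p q : ℝ) (σ : Finset ι) (b v : ℝ) : Prop where
  gram : ∀ c : ι → ℝ, b * ∑ j ∈ σ, c j ^ 2 ≤ ‖∑ j ∈ σ, c j • (‖u j‖⁻¹ • u j)‖ ^ 2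
  frame : ∀ x, inner ℝ (frameOperator (fun j => ‖u j‖⁻¹ • u j) σ x) x ≤ v * ‖x‖ ^ 2
  lower : ∃ R, IsResolventAt (frameOperator (fun j => ‖u j‖⁻¹ • u j) σ) b R ∧
    ∑ j ∈ s, inner ℝ (u j) (R (u j)) ≤ -p
  upper : ∃ N, IsResolventAt (frameOperator (fun j => ‖u j‖⁻¹ • u j) σ) v N ∧
    -q ≤ ∑ j ∈ s, inner ℝ (u j) (N (u j))

variable {s σ : Finset ι} {u : ι → E} {b b' v v' b₀ v₀ h : ℝ}

theorem BarrierState.empty (hh : ∑ j ∈ s, ‖u j‖ ^ 2 = h) (hb₀ : b₀ ≠ 0) (hv₀ : 0 < v₀) :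
    BarrierState s u (h / b₀) (h / v₀) ∅ b₀ v₀ := by
  have key : ∀ c : ℝ, c ≠ 0 → IsResolventAt (frameOperator (fun j => ‖u j‖⁻¹ • u j) ∅) c
      ((-c⁻¹) • (1 : E →ₗ[ℝ] E)) ∧
      ∑ j ∈ s, inner ℝ (u j) (((-c⁻¹) • (1 : E →ₗ[ℝ] E)) (u j)) = -(h / c) := by
    intro c hc
    refine ⟨⟨fun x => ?_, fun x => ?_⟩, ?_⟩
    · simp [frameOperator, smul_smul, hc]
    · simp [frameOperator, smul_smul, hc]
    · simp only [LinearMap.smul_apply, Module.End.one_apply, inner_smul_right,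
        real_inner_self_eq_norm_sq]
      rw [← Finset.mul_sum, hh]
      ring
  refine ⟨fun c => by simp, fun x => ?_, ⟨_, (key b₀ hb₀).1, (key b₀ hb₀).2.le⟩,
    ⟨_, (key v₀ hv₀.ne').1, (key v₀ hv₀.ne').2.ge⟩⟩
  simp only [frameOperator, Finset.sum_empty, LinearMap.zero_apply, inner_zero_left]
  positivity

theorem BarrierState.exists_insert [FiniteDimensional ℝ E] [DecidableEq ι]
    (hst : BarrierState s u (h / b₀) (h / v₀) σ b v)
    (hM : ∀ x, ∑ j ∈ s, inner ℝ (u j) x ^ 2 ≤ ‖x‖ ^ 2)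
    (hh : ∑ j ∈ s, ‖u j‖ ^ 2 = h) (h0 : 0 < h)
    (hb' : 0 < b') (hb : b' < b) (hv : v < v') (hb₀ : 0 < b₀) (hstep : b₀ ≤ (b - b') * h)
    (hsur : (h / v₀ + 1 / (v' - v)) / b' < h / b₀ - h - 1 / (b - b')) :
    ∃ i ∈ s, i ∉ σ ∧ BarrierState s u (h / b₀) (h / v₀) (insert i σ) b' v' := by
  obtain ⟨hgram, hframe, ⟨R, hR, hΦ⟩, ⟨N, hN, hΨ⟩⟩ := hst
  have hA := isSymmetric_frameOperator (w := fun j => ‖u j‖⁻¹ • u j) (σ := σ)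
  have hgap := frameOperator_gap hgram
  have hpos : ∀ z, 0 ≤ inner ℝ (frameOperator (fun j => ‖u j‖⁻¹ • u j) σ z) z := fun z => by
    rw [inner_frameOperator_self]; exact Finset.sum_nonneg fun _ _ => sq_nonneg _
  obtain ⟨R', hR'⟩ := IsResolventAt.exists_of_gap hgap hb' hb
  obtain ⟨N', hN'⟩ := IsResolventAt.exists_of_lt hframe hv
  obtain ⟨i, his, w, hw, h1, h2, h3, h4⟩ := exists_direction hA hpos hgap hframe hM hh h0 hR hR'
    hN hN' hb' hb hv hb₀ hstep hΦ hΨ hsur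
  have hgram' : ∀ c : ι → ℝ,
      b' * ∑ j ∈ σ, c j ^ 2 ≤ ‖∑ j ∈ σ, c j • (‖u j‖⁻¹ • u j)‖ ^ 2 := fun c =>
    (mul_le_mul_of_nonneg_right hb.le (Finset.sum_nonneg fun _ _ => sq_nonneg _)).trans (hgram c)
  have hframe' : ∀ x, inner ℝ (frameOperator (fun j => ‖u j‖⁻¹ • u j) σ x) x ≤ v' * ‖x‖ ^ 2 :=
    fun x => (hframe x).trans (mul_le_mul_of_nonneg_right hv.le (sq_nonneg _))
  obtain ⟨hmem, hgram''⟩ := gram_insert_ge hb' hgram' hR' (i := i) (by rw [← hw]; exact h1)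
  refine ⟨i, his, hmem, hgram'', ?_, ⟨R' - (1 + inner ℝ w (R' w))⁻¹ •
    (innerₛₗ ℝ (R' w)).smulRight (R' w), ?_, ?_⟩, ⟨N' - (1 + inner ℝ w (N' w))⁻¹ •
    (innerₛₗ ℝ (N' w)).smulRight (N' w), ?_, ?_⟩⟩
  · exact frameOperator_insert_le hframe' hN' hmem (by rw [← hw]; exact h2.le)
  · rw [frameOperator_insert hmem, ← hw]
    exact hR'.add_rankOne hA (by linarith)
  · simp only [inner_sub_smul_rankOne]
    rw [Finset.sum_sub_distrib, ← Finset.sum_div]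
    have h5 : 0 < -1 - inner ℝ w (R' w) := by linarith
    have h6 := (div_le_iff₀ h5).2 h3
    have h7 : (1 + inner ℝ w (R' w)) = -(-1 - inner ℝ w (R' w)) := by ring
    rw [h7, div_neg]
    linarith
  · rw [frameOperator_insert hmem, ← hw]
    exact hN'.add_rankOne hA (by linarith)
  · simp only [inner_sub_smul_rankOne]
    rw [Finset.sum_sub_distrib, ← Finset.sum_div]
    have h5 : 0 < 1 + inner ℝ w (N' w) := by linarith
    have h6 := (div_le_iff₀ h5).2 h4
    linarith

/-- Once the lower potential is small enough, one more vector can be added without moving the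
lower barrier. -/
theorem BarrierState.exists_insert_last [DecidableEq ι] {p q : ℝ} (hst : BarrierState s u p q σ b v)
    (hh : ∑ j ∈ s, ‖u j‖ ^ 2 = h) (hb : 0 < b) (hp : h < p) :
    ∃ i ∈ s, i ∉ σ ∧
      (∀ c : ι → ℝ, b * ∑ j ∈ insert i σ, c j ^ 2 ≤
        ‖∑ j ∈ insert i σ, c j • (‖u j‖⁻¹ • u j)‖ ^ 2) ∧
      ∀ x, inner ℝ (frameOperator (fun j => ‖u j‖⁻¹ • u j) (insert i σ) x) x ≤
        (v + 1) * ‖x‖ ^ 2 := by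
  obtain ⟨hgram, hframe, ⟨R, hR, hΦ⟩, -⟩ := hst
  obtain ⟨i, his, hi⟩ : ∃ i ∈ s, inner ℝ (u i) (R (u i)) < -‖u i‖ ^ 2 := by
    refine Finset.exists_lt_of_sum_lt ?_
    rw [Finset.sum_neg_distrib, hh]
    linarith
  have hn0 : 0 < ‖u i‖ := by
    refine (norm_nonneg _).lt_of_ne' fun h => ?_
    rw [norm_eq_zero] at h
    simp [h] at hi
  have hquad : inner ℝ (‖u i‖⁻¹ • u i) (R (‖u i‖⁻¹ • u i)) < -1 := by
    simp only [map_smul, inner_smul_left, inner_smul_right, conj_trivial]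
    rw [← mul_assoc, ← mul_inv, ← sq, ← div_eq_inv_mul, div_lt_iff₀ (by positivity)]
    linarith
  obtain ⟨hmem, hgram'⟩ := gram_insert_ge hb hgram hR (i := i) hquad
  refine ⟨i, his, hmem, hgram', fun x => ?_⟩
  have h1 := hframe x
  rw [inner_frameOperator_self] at h1 ⊢
  rw [Finset.sum_insert hmem]
  have h2 : inner ℝ (‖u i‖⁻¹ • u i) x ^ 2 ≤ ‖x‖ ^ 2 := by
    have := abs_real_inner_le_norm (‖u i‖⁻¹ • u i) x
    rw [norm_smul, norm_inv, norm_norm, inv_mul_cancel₀ hn0.ne', one_mul] at this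
    rw [← sq_abs]
    gcongr
  linarith

/-- Restricted invertibility in a finite-dimensional space, with two-sided bounds for the
normalized vectors. -/
theorem exists_normalized_riesz [FiniteDimensional ℝ E]
    (hM : ∀ x, ∑ j ∈ s, inner ℝ (u j) x ^ 2 ≤ ‖x‖ ^ 2) {ε : ℝ} (hε : 0 < ε) (hε1 : ε < 1)
    (hpos : 0 < ∑ j ∈ s, ‖u j‖ ^ 2) :
    ∃ σ ⊆ s, (1 - ε) * ∑ j ∈ s, ‖u j‖ ^ 2 ≤ σ.card ∧ ∀ c : ι → ℝ,
      ε ^ 2 / 8 * ∑ j ∈ σ, c j ^ 2 ≤ ‖∑ j ∈ σ, c j • (‖u j‖⁻¹ • u j)‖ ^ 2 ∧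
      ‖∑ j ∈ σ, c j • (‖u j‖⁻¹ • u j)‖ ^ 2 ≤ (128 / ε ^ 2 + 1) * ∑ j ∈ σ, c j ^ 2 := by
  classical
  obtain ⟨h, hh⟩ : ∃ h, ∑ j ∈ s, ‖u j‖ ^ 2 = h := ⟨_, rfl⟩
  rw [hh] at hpos ⊢
  set θ : ℝ := 1 - 3 / 4 * ε with hθ
  have hθ0 : 0 < θ := by linarith
  have hθ1 : θ ≤ 1 := by linarith
  set δ : ℝ := ε / 2 / θ / h with hδ
  have hδ0 : 0 < δ := by positivity
  set η : ℝ := 64 / (ε ^ 2 * h) with hη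
  have hη0 : 0 < η := by positivity
  have hlow : ∀ k : ℕ, (k : ℝ) ≤ (1 - ε) * h → ε ^ 2 / 8 ≤ ε / 2 - k * δ := by
    intro k hk
    have h1 : (k : ℝ) * δ ≤ (1 - ε) * h * δ := by gcongr
    have h2 : (1 - ε) * h * δ = ε / 2 * ((1 - ε) / θ) := by rw [hδ]; field_simp
    have h3 : (1 - ε) / θ ≤ 1 - ε / 4 := by
      rw [div_le_iff₀ hθ0, hθ]; nlinarith
    have h4 : ε / 2 * ((1 - ε) / θ) ≤ ε / 2 * (1 - ε / 4) := by gcongr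
    linarith
  have hind : ∀ k : ℕ, (k : ℝ) ≤ (1 - ε) * h → ∃ σ ⊆ s, σ.card = k ∧
      BarrierState s u (h / (ε / 2)) (h / (64 / ε ^ 2)) σ (ε / 2 - k * δ)
        (64 / ε ^ 2 + k * η) := by
    intro k
    induction k with
    | zero =>
      intro _
      refine ⟨∅, by simp, rfl, ?_⟩
      simpa using BarrierState.empty hh (by positivity : ε / 2 ≠ 0)
        (by positivity : 0 < 64 / ε ^ 2)
    | succ k ih =>
      intro hk
      obtain ⟨σ, hσ, hcard, hst⟩ := ih (le_trans (by push_cast; linarith) hk)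
      have hb := hlow _ hk
      have hδh : δ * h = ε / 2 / θ := by rw [hδ]; field_simp
      have e1 : ε / 2 - k * δ - (ε / 2 - (k + 1 : ℕ) * δ) = δ := by push_cast; ring
      have e2 : 64 / ε ^ 2 + (k + 1 : ℕ) * η - (64 / ε ^ 2 + k * η) = η := by push_cast; ring
      have hb0 : 0 < ε ^ 2 / 8 := by positivity
      obtain ⟨i, his, hi, hst'⟩ := hst.exists_insert hM hh hpos (b' := ε / 2 - (k + 1 : ℕ) * δ)
        (v' := 64 / ε ^ 2 + (k + 1 : ℕ) * η) (hb0.trans_le hb) (by linarith) (by linarith)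
        (by positivity) (by
          rw [e1, hδh, le_div_iff₀ hθ0]
          exact mul_le_of_le_one_right (by positivity) hθ1) (by
          rw [e1, e2]
          have e3 : h / (64 / ε ^ 2) + 1 / η = ε ^ 2 / 8 * (h / 4) := by
            rw [hη]; field_simp; norm_num
          have e4 : h / (ε / 2) - h - 1 / δ = h / 2 := by
            rw [hδ, hθ]; field_simp; ring
          rw [e3, e4, div_lt_iff₀ (hb0.trans_le hb)]
          nlinarith)
      exact ⟨insert i σ, Finset.insert_subset his hσ, by rw [Finset.card_insert_of_notMem hi, hcard],
        hst'⟩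
  have hnn : 0 ≤ (1 - ε) * h := mul_nonneg (by linarith) hpos.le
  have hk := Nat.floor_le hnn
  obtain ⟨σ, hσ, hcard, hst⟩ := hind _ hk
  have hb := hlow _ hk
  have hb0 : 0 < ε ^ 2 / 8 := by positivity
  obtain ⟨i, his, hi, hgram, hframe⟩ := hst.exists_insert_last hh (hb0.trans_le hb) (by
    rw [lt_div_iff₀ (by positivity)]; nlinarith)
  refine ⟨insert i σ, Finset.insert_subset his hσ, ?_, fun c => ?_⟩
  · rw [Finset.card_insert_of_notMem hi, hcard]
    exact_mod_cast (Nat.lt_floor_add_one _).le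
  · have hc : 0 ≤ ∑ j ∈ insert i σ, c j ^ 2 := Finset.sum_nonneg fun _ _ => sq_nonneg _
    refine ⟨(mul_le_mul_of_nonneg_right hb hc).trans (hgram c),
      (norm_sum_smul_sq_le (by positivity) hframe c).trans (mul_le_mul_of_nonneg_right ?_ hc)⟩
    have h1 : (⌊(1 - ε) * h⌋₊ : ℝ) * η ≤ h * η := by
      gcongr
      nlinarith
    have h2 : h * η = 64 / ε ^ 2 := by rw [hη]; field_simp
    have h3 : 128 / ε ^ 2 = 64 / ε ^ 2 + 64 / ε ^ 2 := by ring
    linarith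

end Selection

/-- Bessel's inequality for the images of an orthonormal family under a contraction. -/
theorem sum_inner_map_sq_le {H ι : Type*} [NormedAddCommGroup H] [InnerProductSpace ℝ H]
    [CompleteSpace H] {T : H →L[ℝ] H} (hT : ‖T‖ ≤ 1) {e : ι → H} (he : Orthonormal ℝ e)
    (s : Finset ι) (x : H) : ∑ j ∈ s, inner ℝ (T (e j)) x ^ 2 ≤ ‖x‖ ^ 2 := by
  have h1 := he.sum_inner_products_le (T.adjoint x) (s := s)
  simp only [ContinuousLinearMap.adjoint_inner_right, Real.norm_eq_abs, sq_abs] at h1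
  refine h1.trans ?_
  gcongr
  refine (T.adjoint.le_opNorm x).trans ?_
  rw [LinearIsometryEquiv.norm_map]
  exact mul_le_of_le_one_left (norm_nonneg _) hT

theorem orthonormal_lp_single :
    Orthonormal ℝ (fun j : ℕ => (lp.single 2 j (1 : ℝ) : lp (fun _ : ℕ => ℝ) 2)) := by
  rw [orthonormal_iff_ite]
  intro i j
  rw [lp.inner_single_left]
  simp [lp.single_apply, Pi.single_apply]


/-- restricted invertibility, Hilbert–Schmidt form. For every
`ε ∈ (0,1)` there is `C(ε) > 0` such that for every Hilbert–Schmidt operator `T` on `ℓ₂`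
with `‖T‖ = 1` there is a finite subset `σ ⊆ ℕ` of cardinality `|σ| ≥ (1-ε)‖T‖_HS²`
such that `(T e j)_{j ∈ σ}` is `C(ε)`-equivalent to an orthogonal basis in Hilbert
space. -/
theorem restricted_invertibility_hs :
    ∀ ε : ℝ, ε ∈ Set.Ioo (0 : ℝ) 1 → ∃ C : ℝ, 0 < C ∧
      ∀ T : lp (fun _ : ℕ => ℝ) 2 →L[ℝ] lp (fun _ : ℕ => ℝ) 2, ‖T‖ = 1 →
      Summable (fun j : ℕ => ‖T (lp.single 2 j (1 : ℝ))‖ ^ 2) →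
      ∃ σ : Finset ℕ,
        (1 - ε) * (∑' j : ℕ, ‖T (lp.single 2 j (1 : ℝ))‖ ^ 2) ≤ σ.card ∧
        ∃ (lam : ℕ → ℝ) (K₁ K₂ : ℝ),
          (∀ j ∈ σ, lam j ≠ 0) ∧ 0 < K₁ ∧ 0 < K₂ ∧ K₁ * K₂ ≤ C ∧
          ∀ a : ℕ → ℝ,
            K₁⁻¹ * Real.sqrt (∑ j ∈ σ, (a j) ^ 2)
                ≤ ‖∑ j ∈ σ, (a j * lam j) • T (lp.single 2 j (1 : ℝ))‖ ∧
            ‖∑ j ∈ σ, (a j * lam j) • T (lp.single 2 j (1 : ℝ))‖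
                ≤ K₂ * Real.sqrt (∑ j ∈ σ, (a j) ^ 2) := by
  intro ε hε
  obtain ⟨hε0, hε1⟩ := hε
  set m : ℝ := (ε / 2) ^ 2 / 8 with hm
  set M : ℝ := 128 / (ε / 2) ^ 2 + 1 with hM
  have hm0 : 0 < m := by positivity
  have hM0 : 0 < M := by positivity
  refine ⟨(√m)⁻¹ * √M, by positivity, fun T hT hsum => ?_⟩
  set e : ℕ → lp (fun _ : ℕ => ℝ) 2 := fun j => lp.single 2 j (1 : ℝ) with he
  change Summable (fun j => ‖T (e j)‖ ^ 2) at hsum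
  obtain ⟨s, hs⟩ : ∃ s : Finset ℕ, (1 - ε / 2) * ∑' j, ‖T (e j)‖ ^ 2 ≤ ∑ j ∈ s, ‖T (e j)‖ ^ 2 := by
    rcases (tsum_nonneg fun j => sq_nonneg ‖T (e j)‖ :
      0 ≤ ∑' j, ‖T (e j)‖ ^ 2).eq_or_lt with h0 | h0
    · exact ⟨∅, by simp [← h0]⟩
    · have hlt : (1 - ε / 2) * ∑' j, ‖T (e j)‖ ^ 2 < ∑' j, ‖T (e j)‖ ^ 2 := by nlinarith
      obtain ⟨s, hs⟩ := (hsum.hasSum.eventually (lt_mem_nhds hlt)).exists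
      exact ⟨s, hs.le⟩
  obtain ⟨σ, hcard, hσ⟩ : ∃ σ : Finset ℕ,
      (1 - ε / 2) * ∑ j ∈ s, ‖T (e j)‖ ^ 2 ≤ σ.card ∧ ∀ c : ℕ → ℝ,
        m * ∑ j ∈ σ, c j ^ 2 ≤ ‖∑ j ∈ σ, (c j * ‖T (e j)‖⁻¹) • T (e j)‖ ^ 2 ∧
        ‖∑ j ∈ σ, (c j * ‖T (e j)‖⁻¹) • T (e j)‖ ^ 2 ≤ M * ∑ j ∈ σ, c j ^ 2 := by
    rcases (Finset.sum_nonneg fun j _ => sq_nonneg ‖T (e j)‖ :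
      0 ≤ ∑ j ∈ s, ‖T (e j)‖ ^ 2).eq_or_lt with h0 | h0
    · exact ⟨∅, by simp [← h0], by simp⟩
    let E := Submodule.span ℝ ((fun j => T (e j)) '' (s : Set ℕ))
    have : FiniteDimensional ℝ E :=
      FiniteDimensional.span_of_finite ℝ (s.finite_toSet.image _)
    classical
    let u : ℕ → E := fun j => if hj : j ∈ s then
      ⟨T (e j), Submodule.subset_span (Set.mem_image_of_mem _ hj)⟩ else 0
    have hu : ∀ j ∈ s, (u j : lp (fun _ : ℕ => ℝ) 2) = T (e j) := fun j hj => by simp [u, hj]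
    have hnorm : ∀ j ∈ s, ‖u j‖ = ‖T (e j)‖ := fun j hj => by
      rw [← hu j hj, Submodule.coe_norm]
    have hsu : ∑ j ∈ s, ‖u j‖ ^ 2 = ∑ j ∈ s, ‖T (e j)‖ ^ 2 :=
      Finset.sum_congr rfl fun j hj => by rw [hnorm j hj]
    obtain ⟨σ, hσs, hcard, hσ⟩ := exists_normalized_riesz (s := s) (u := u) (fun x => by
      refine le_trans (le_of_eq ?_)
        (sum_inner_map_sq_le hT.le orthonormal_lp_single s (x : lp (fun _ : ℕ => ℝ) 2))
      refine Finset.sum_congr rfl fun j hj => ?_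
      rw [Submodule.coe_inner, hu j hj]) (half_pos hε0) (by linarith) (hsu ▸ h0)
    refine ⟨σ, hsu ▸ hcard, fun c => ?_⟩
    have hc : ‖∑ j ∈ σ, (c j * ‖T (e j)‖⁻¹) • T (e j)‖ =
        ‖∑ j ∈ σ, c j • (‖u j‖⁻¹ • u j)‖ := by
      rw [Submodule.coe_norm, Submodule.coe_sum]
      congr 1
      refine Finset.sum_congr rfl fun j hj => ?_
      rw [Submodule.coe_smul, Submodule.coe_smul, hu j (hσs hj), hnorm j (hσs hj), smul_smul]
    rw [hc]
    exact hσ c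
  refine ⟨σ, ?_, fun j => ‖T (e j)‖⁻¹, (√m)⁻¹, √M, fun j hj => ?_, by positivity, by positivity,
    le_rfl, fun a => ?_⟩
  · refine le_trans ?_ hcard
    have h0 : 0 ≤ ∑' j, ‖T (e j)‖ ^ 2 := tsum_nonneg fun j => sq_nonneg _
    have h1 := mul_le_mul_of_nonneg_left hs (by linarith : 0 ≤ 1 - ε / 2)
    refine le_trans ?_ h1
    rw [← mul_assoc]
    refine mul_le_mul_of_nonneg_right ?_ h0
    nlinarith
  · intro h0
    have h1 := (hσ fun i => if i = j then 1 else 0).1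
    simp [hj, h0] at h1
    linarith
  · obtain ⟨h1, h2⟩ := hσ a
    rw [inv_inv, ← Real.sqrt_mul hm0.le, ← Real.sqrt_mul hM0.le]
    exact ⟨Real.sqrt_le_iff.2 ⟨norm_nonneg _, h1⟩, Real.le_sqrt_of_sq_le h2⟩
end

section
/- Let (x_j)_{j≥1} be a decomposition of the identity on a Hilbert space H, and let T : H → H be a bounded linear operator which is not Hilbert–Schmidt (i.e. Σ_k ‖T e_k‖² = ∞ for an orthonormal basis (e_k)). Then for every ε > 0 there exists an infinite subset σ of the index set such that the sequence (T x_j)_{j∈σ} is (1+ε)-equivalent to an orthogonal basis in Hilbert space. -/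
open scoped RealInnerProductSpace

lemma ennreal_ofReal_eq_tsum_of_hasSum {α : Type*} {f : α → ℝ} {s : ℝ} (hf : ∀ i, 0 ≤ f i)
    (h : HasSum f s) : ENNReal.ofReal s = ∑' i, ENNReal.ofReal (f i) := by
  rw [← h.tsum_eq, ENNReal.ofReal_tsum_of_nonneg hf h.summable]

section Parseval

variable {H : Type*} [NormedAddCommGroup H] [InnerProductSpace ℝ H]

/-- A decomposition of the identity satisfies Parseval's identity. -/
lemma hasSum_inner_sq_of_decomposition {ι : Type*} {x : ι → H}
    (hx : ∀ v : H, HasSum (fun j => ⟪x j, v⟫ • x j) v) (v : H) :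
    HasSum (fun j => ⟪x j, v⟫ ^ 2) (‖v‖ ^ 2) := by
  have h := (hx v).mapL (innerSL ℝ v)
  simp only [map_smul, innerSL_apply_apply, smul_eq_mul, real_inner_self_eq_norm_sq] at h
  refine h.congr_fun fun j => ?_
  rw [real_inner_comm (x j) v, sq]

lemma HilbertBasis.hasSum_inner_sq {ι : Type*} (b : HilbertBasis ι ℝ H) (v : H) :
    HasSum (fun i => ⟪b i, v⟫ ^ 2) (‖v‖ ^ 2) := by
  have h := b.hasSum_inner_mul_inner v v
  rw [real_inner_self_eq_norm_sq] at h
  refine h.congr_fun fun j => ?_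
  rw [real_inner_comm (b j) v, sq]

/-- The Hilbert–Schmidt sums of an operator and of its adjoint agree, along any two families
satisfying Parseval's identity. -/
lemma tsum_norm_sq_eq_tsum_norm_adjoint_sq [CompleteSpace H] {ι κ : Type*} {u : ι → H} {w : κ → H}
    (hu : ∀ v : H, HasSum (fun i => ⟪u i, v⟫ ^ 2) (‖v‖ ^ 2))
    (hw : ∀ v : H, HasSum (fun i => ⟪w i, v⟫ ^ 2) (‖v‖ ^ 2)) (A : H →L[ℝ] H) :
    ∑' i, ENNReal.ofReal (‖A (u i)‖ ^ 2) =
      ∑' j, ENNReal.ofReal (‖ContinuousLinearMap.adjoint A (w j)‖ ^ 2) := by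
  calc ∑' i, ENNReal.ofReal (‖A (u i)‖ ^ 2)
      = ∑' i, ∑' j, ENNReal.ofReal (⟪w j, A (u i)⟫ ^ 2) :=
        tsum_congr fun _ => ennreal_ofReal_eq_tsum_of_hasSum (fun _ => sq_nonneg _) (hw _)
    _ = ∑' j, ∑' i, ENNReal.ofReal (⟪w j, A (u i)⟫ ^ 2) := ENNReal.tsum_comm
    _ = ∑' j, ∑' i, ENNReal.ofReal (⟪u i, ContinuousLinearMap.adjoint A (w j)⟫ ^ 2) := by
        simp only [ContinuousLinearMap.adjoint_inner_right, real_inner_comm]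
    _ = _ :=
        (tsum_congr fun _ => ennreal_ofReal_eq_tsum_of_hasSum (fun _ => sq_nonneg _) (hu _)).symm

/-- If `∑ ‖T (b k)‖ ^ 2` diverges along an orthonormal basis `b`, then it diverges along every
family satisfying Parseval's identity. -/
lemma not_summable_norm_sq_of_parseval [CompleteSpace H] {ι κ : Type*} {x : ι → H}
    (hx : ∀ v : H, HasSum (fun j => ⟪x j, v⟫ ^ 2) (‖v‖ ^ 2)) (T : H →L[ℝ] H)
    (b : HilbertBasis κ ℝ H) (hT : ¬ Summable (fun k => ‖T (b k)‖ ^ 2)) :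
    ¬ Summable (fun j => ‖T (x j)‖ ^ 2) := by
  intro hs
  apply hT
  have h1 := tsum_norm_sq_eq_tsum_norm_adjoint_sq b.hasSum_inner_sq b.hasSum_inner_sq T
  have h2 := tsum_norm_sq_eq_tsum_norm_adjoint_sq b.hasSum_inner_sq hx
    (ContinuousLinearMap.adjoint T)
  rw [ContinuousLinearMap.adjoint_adjoint] at h2
  have h3 : ∑' k, ENNReal.ofReal (‖T (b k)‖ ^ 2) ≠ ⊤ := by
    rw [h1, h2, ← ENNReal.ofReal_tsum_of_nonneg (fun _ => sq_nonneg _) hs]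
    exact ENNReal.ofReal_ne_top
  refine (ENNReal.summable_toReal h3).congr fun k => ?_
  rw [ENNReal.toReal_ofReal (sq_nonneg _)]

/-- If `∑ ‖T (x j)‖ ^ 2` diverges, some nonzero `T (x j)` is almost orthogonal to any prescribed
finite set of vectors. -/
lemma exists_almost_orthogonal_of_parseval [CompleteSpace H] {ι : Type*} {x : ι → H}
    (hx : ∀ v : H, HasSum (fun j => ⟪x j, v⟫ ^ 2) (‖v‖ ^ 2)) (T : H →L[ℝ] H)
    (hT : ¬ Summable (fun j => ‖T (x j)‖ ^ 2)) (s : Finset H) {δ : ℝ} (hδ : 0 < δ) :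
    ∃ j, T (x j) ≠ 0 ∧ ∀ y ∈ s, |⟪y, T (x j)⟫| ≤ δ * ‖T (x j)‖ := by
  by_contra! hcon
  apply hT
  have hsum : Summable fun j => ∑ y ∈ s, ⟪y, T (x j)⟫ ^ 2 := by
    refine summable_sum fun y _ => ?_
    refine (hx (ContinuousLinearMap.adjoint T y)).summable.congr fun j => ?_
    rw [ContinuousLinearMap.adjoint_inner_right, real_inner_comm]
  refine (hsum.mul_left ((δ ^ 2)⁻¹)).of_nonneg_of_le (fun _ => sq_nonneg _) fun j => ?_
  rw [inv_mul_eq_div, le_div_iff₀ (by positivity)]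
  by_cases h0 : T (x j) = 0
  · simp [h0]
  obtain ⟨y, hy, hlt⟩ := hcon j h0
  calc ‖T (x j)‖ ^ 2 * δ ^ 2 = (δ * ‖T (x j)‖) ^ 2 := by ring
    _ ≤ |⟪y, T (x j)⟫| ^ 2 := by gcongr
    _ = ⟪y, T (x j)⟫ ^ 2 := sq_abs _
    _ ≤ _ := Finset.single_le_sum (f := fun y => ⟪y, T (x j)⟫ ^ 2) (fun _ _ => sq_nonneg _) hy

/-- Unit vectors whose Gram matrix is a small perturbation of the identity satisfy the
Pythagorean identity up to a small error. -/
lemma abs_norm_sum_sq_sub_le {ι : Type*} {y : ι → H} {c : ι → ℝ} {η : ℝ}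
    (hη : 0 ≤ η) (hc : ∀ i, 0 ≤ c i) (hy : ∀ i, ‖y i‖ = 1)
    (hyc : ∀ i j, i ≠ j → |⟪y i, y j⟫| ≤ η * (c i * c j))
    (t : Finset ι) (ht : ∑ i ∈ t, c i ^ 2 ≤ 1) (a : ι → ℝ) :
    |‖∑ i ∈ t, a i • y i‖ ^ 2 - ∑ i ∈ t, a i ^ 2| ≤ η * ∑ i ∈ t, a i ^ 2 := by
  classical
  have hexp : ‖∑ i ∈ t, a i • y i‖ ^ 2 - ∑ i ∈ t, a i ^ 2 =
      ∑ i ∈ t, ∑ j ∈ t, (a i * a j * ⟪y i, y j⟫ - if i = j then a i ^ 2 else 0) := by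
    rw [← real_inner_self_eq_norm_sq, sum_inner, ← Finset.sum_sub_distrib]
    refine Finset.sum_congr rfl fun i hi => ?_
    rw [inner_sum, Finset.sum_sub_distrib, Finset.sum_ite_eq, if_pos hi]
    congr 1
    refine Finset.sum_congr rfl fun j _ => ?_
    rw [real_inner_smul_left, real_inner_smul_right]
    ring
  rw [hexp]
  have hterm (i j : ι) : |a i * a j * ⟪y i, y j⟫ - if i = j then a i ^ 2 else 0| ≤
      η * ((|a i| * c i) * (|a j| * c j)) := by
    by_cases hij : i = j
    · subst hij
      have := hc i
      rw [if_pos rfl, real_inner_self_eq_norm_sq, hy]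
      ring_nf
      simp only [abs_zero]
      positivity
    · rw [if_neg hij, sub_zero, abs_mul, abs_mul]
      calc |a i| * |a j| * |⟪y i, y j⟫| ≤ |a i| * |a j| * (η * (c i * c j)) := by
            gcongr
            exact hyc i j hij
        _ = _ := by ring
  calc _ ≤ ∑ i ∈ t, ∑ j ∈ t, η * ((|a i| * c i) * (|a j| * c j)) :=
        (Finset.abs_sum_le_sum_abs _ _).trans <| Finset.sum_le_sum fun i _ =>
          (Finset.abs_sum_le_sum_abs _ _).trans <| Finset.sum_le_sum fun j _ => hterm i j
    _ = η * (∑ i ∈ t, |a i| * c i) ^ 2 := by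
        rw [sq, Finset.sum_mul_sum, Finset.mul_sum]
        simp only [Finset.mul_sum]
    _ ≤ η * ((∑ i ∈ t, |a i| ^ 2) * ∑ i ∈ t, c i ^ 2) := by
        gcongr
        exact Finset.sum_mul_sq_le_sq_mul_sq _ _ _
    _ ≤ η * ((∑ i ∈ t, |a i| ^ 2) * 1) := by gcongr
    _ = _ := by simp only [sq_abs, mul_one]

/-- If `∑ ‖T (x j)‖ ^ 2` diverges, one can select a sequence of indices along which the normalized
vectors `T (x j)` are almost orthogonal, with rapidly decaying inner products. -/
lemma exists_almost_orthogonal_subsequence [CompleteSpace H] {ι : Type*} {x : ι → H}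
    (hx : ∀ v : H, HasSum (fun j => ⟪x j, v⟫ ^ 2) (‖v‖ ^ 2)) (T : H →L[ℝ] H)
    (hT : ¬ Summable (fun j => ‖T (x j)‖ ^ 2)) {η : ℝ} (hη : 0 < η) :
    ∃ f : ℕ → ι, (∀ n, T (x (f n)) ≠ 0) ∧ ∀ m n, m ≠ n →
      |⟪‖T (x (f m))‖⁻¹ • T (x (f m)), ‖T (x (f n))‖⁻¹ • T (x (f n))⟫| ≤
        η * ((1 / 2) ^ (m + 1) * (1 / 2) ^ (n + 1)) := by
  classical
  set y : ι → H := fun j => ‖T (x j)‖⁻¹ • T (x j) with hy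
  obtain ⟨g, hg0, hg⟩ := exists_seq_of_forall_finset_exists
    (fun p : ℕ × ι => T (x p.2) ≠ 0)
    (fun p q => p.1 < q.1 ∧ |⟪y p.2, y q.2⟫| ≤ η * (1 / 4) ^ (q.1 + 1)) (by
      intro s _
      obtain ⟨j, hj0, hj⟩ := exists_almost_orthogonal_of_parseval hx T hT
        (s.image fun p => y p.2) (δ := η * (1 / 4) ^ (s.sup Prod.fst + 1 + 1)) (by positivity)
      refine ⟨(s.sup Prod.fst + 1, j), hj0, fun p hp =>
        ⟨Nat.lt_succ_of_le (Finset.le_sup (f := Prod.fst) hp), ?_⟩⟩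
      have h := hj (y p.2) (Finset.mem_image_of_mem _ hp)
      have hpos : 0 < ‖T (x j)‖ := norm_pos_iff.2 hj0
      simp only [hy, real_inner_smul_right, abs_mul, abs_inv, abs_norm] at h ⊢
      rwa [inv_mul_le_iff₀ hpos, mul_comm ‖T (x j)‖])
  have hmono : StrictMono fun n => (g n).1 := fun m n hmn => (hg m n hmn).1
  have hlt (m n : ℕ) (hmn : m < n) :
      |⟪y (g m).2, y (g n).2⟫| ≤ η * ((1 / 2) ^ (m + 1) * (1 / 2) ^ (n + 1)) := by
    refine (hg m n hmn).2.trans ?_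
    gcongr
    calc (1 / 4 : ℝ) ^ ((g n).1 + 1) ≤ (1 / 4) ^ (n + 1) :=
          pow_le_pow_of_le_one (by norm_num) (by norm_num) (Nat.succ_le_succ (hmono.id_le n))
      _ = (1 / 2) ^ (n + 1) * (1 / 2) ^ (n + 1) := by rw [← mul_pow]; norm_num
      _ ≤ (1 / 2) ^ (m + 1) * (1 / 2) ^ (n + 1) := by
          gcongr ?_ * _
          exact pow_le_pow_of_le_one (by norm_num) (by norm_num) (by omega)
  refine ⟨fun n => (g n).2, hg0, fun m n hmn => ?_⟩
  rcases lt_or_gt_of_ne hmn with h | h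
  · exact hlt m n h
  · rw [real_inner_comm, mul_comm ((1 / 2 : ℝ) ^ (m + 1))]
    exact hlt n m h

end Parseval

lemma sum_half_pow_succ_sq_le_one (t : Finset ℕ) : ∑ n ∈ t, ((1 / 2 : ℝ) ^ (n + 1)) ^ 2 ≤ 1 := by
  have h := (hasSum_geometric_two' (1 : ℝ))
  calc ∑ n ∈ t, ((1 / 2 : ℝ) ^ (n + 1)) ^ 2 ≤ ∑ n ∈ t, 1 / 2 / 2 ^ n := by
        refine Finset.sum_le_sum fun n _ => ?_
        calc ((1 / 2 : ℝ) ^ (n + 1)) ^ 2 ≤ (1 / 2 : ℝ) ^ (n + 1) :=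
              pow_le_of_le_one (by positivity)
                (pow_le_one₀ (by norm_num) (by norm_num)) two_ne_zero
          _ = 1 / 2 / 2 ^ n := by rw [pow_succ, one_div_pow]; ring
    _ ≤ 1 := sum_le_hasSum t (fun _ _ => by positivity) h

/-- Let `(x j)` be a decomposition of the identity on a Hilbert space
`H`, and let `T` be a bounded operator which is not Hilbert–Schmidt (with respect to an
orthonormal basis `b`). Then for every `ε > 0` there is an infinite subset `σ ⊆ ℕ` such
that `(T x j)_{j ∈ σ}` is `(1+ε)`-equivalent to an orthogonal basis in Hilbert space. -/
theorem infinite_selection_of_non_hilbert_schmidt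
    {H : Type*} [NormedAddCommGroup H] [InnerProductSpace ℝ H] [CompleteSpace H]
    (x : ℕ → H)
    (hx : ∀ v : H, HasSum (fun j => ⟪x j, v⟫ • x j) v)
    (T : H →L[ℝ] H) {K : Type*} (b : HilbertBasis K ℝ H)
    (hT : ¬ Summable (fun k => ‖T (b k)‖ ^ 2))
    (ε : ℝ) (hε : 0 < ε) :
    ∃ σ : Set ℕ, σ.Infinite ∧
      ∃ (lam : ℕ → ℝ) (K₁ K₂ : ℝ),
        (∀ j ∈ σ, lam j ≠ 0) ∧ 0 < K₁ ∧ 0 < K₂ ∧ K₁ * K₂ ≤ 1 + ε ∧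
        ∀ a : ℕ →₀ ℝ, (a.support : Set ℕ) ⊆ σ →
          K₁⁻¹ * Real.sqrt (∑ j ∈ a.support, (a j) ^ 2)
              ≤ ‖∑ j ∈ a.support, (a j * lam j) • T (x j)‖ ∧
          ‖∑ j ∈ a.support, (a j * lam j) • T (x j)‖
              ≤ K₂ * Real.sqrt (∑ j ∈ a.support, (a j) ^ 2) := by
  have hP := hasSum_inner_sq_of_decomposition hx
  set η : ℝ := ε / (2 + ε) with hη
  have hη0 : 0 < η := by positivity
  have hη1 : η < 1 := by rw [hη, div_lt_one (by positivity)]; linarith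
  obtain ⟨f, hf0, hf⟩ := exists_almost_orthogonal_subsequence hP T
    (not_summable_norm_sq_of_parseval hP T b hT) hη0
  have hunit (n : ℕ) : ‖‖T (x (f n))‖⁻¹ • T (x (f n))‖ = 1 := by
    rw [norm_smul, norm_inv, norm_norm, inv_mul_cancel₀ (norm_ne_zero_iff.2 (hf0 n))]
  have hinj : Function.Injective f := by
    intro m n hmn
    by_contra hne
    have h := hf m n hne
    rw [hmn, real_inner_self_eq_norm_sq, hunit] at h
    have h2 : ((1 / 2 : ℝ) ^ (m + 1) * (1 / 2) ^ (n + 1)) ≤ 1 :=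
      mul_le_one₀ (pow_le_one₀ (by norm_num) (by norm_num)) (by positivity)
        (pow_le_one₀ (by norm_num) (by norm_num))
    norm_num only [one_pow, abs_one] at h
    nlinarith
  refine ⟨Set.range f, Set.infinite_range_of_injective hinj, fun j => ‖T (x j)‖⁻¹,
    (1 - η)⁻¹, 1 + η, ?_, inv_pos.2 (by linarith), by linarith, ?_, fun a ha => ?_⟩
  · rintro _ ⟨n, rfl⟩
    exact inv_ne_zero (norm_ne_zero_iff.2 (hf0 n))
  · rw [inv_mul_le_iff₀ (by linarith)]
    apply le_of_eq
    rw [hη]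
    field_simp
    ring
  obtain ⟨t, ht⟩ : ∃ t : Finset ℕ, t.image f = a.support := by
    rw [← Set.image_univ] at ha
    obtain ⟨t, -, ht⟩ := Finset.subset_set_image_iff.1 ha
    exact ⟨t, ht⟩
  have key := abs_norm_sum_sq_sub_le hη0.le (fun n => by positivity) hunit hf t
    (sum_half_pow_succ_sq_le_one t) (fun n => a (f n))
  rw [← ht, Finset.sum_image hinj.injOn, Finset.sum_image hinj.injOn, inv_inv]
  simp only [mul_smul]
  set S := ∑ n ∈ t, a (f n) ^ 2
  have hS : 0 ≤ S := Finset.sum_nonneg fun _ _ => sq_nonneg _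
  have hsq := Real.sq_sqrt hS
  obtain ⟨h1, h2⟩ := abs_le.1 key
  constructor
  · refine (sq_le_sq₀ (mul_nonneg (by linarith) (Real.sqrt_nonneg _)) (norm_nonneg _)).1 ?_
    rw [mul_pow, hsq]
    nlinarith [mul_nonneg (mul_nonneg hη0.le (sub_nonneg.2 hη1.le)) hS]
  · refine (sq_le_sq₀ (norm_nonneg _) (mul_nonneg (by linarith) (Real.sqrt_nonneg _))).1 ?_
    rw [mul_pow, hsq]
    nlinarith [mul_nonneg hη0.le hS, mul_nonneg (mul_nonneg hη0.le hη0.le) hS]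
end
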